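/- arXiv:2203.00397 — 13 statements merged into one kernel-verified Lean document; each statement's English description precedes it below -/
import Mathlib

section
/- Let M = (S, A, R, T, γ) be a finite MDP and φ : S → S_φ a state abstraction with weighting function w. Suppose there is ε ≥ 0 such that whenever φ(s1) = φ(s2), |Q*(s1,a) − Q*(s2,a)| ≤ ε for every action a ∈ A. Then for every state s ∈ S and action a ∈ A, |Q*(s,a) − Q*_φ(φ(s),a)| ≤ ε/(1−γ). -/
open Finset

/-- A convex combination of reals bounded by `c` in absolute value is bounded by `c`. -/
theorem abs_sum_mul_le_of_weights {ι : Type*} (s : Finset ι) (w f : ι → ℝ) (c : ℝ)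
    (hw : ∀ i ∈ s, 0 ≤ w i) (hsum : ∑ i ∈ s, w i = 1) (hf : ∀ i ∈ s, |f i| ≤ c) :
    |∑ i ∈ s, w i * f i| ≤ c := by
  calc |∑ i ∈ s, w i * f i| ≤ ∑ i ∈ s, |w i * f i| := abs_sum_le_sum_abs _ _
    _ ≤ ∑ i ∈ s, w i * c := sum_le_sum fun i hi => by
        rw [abs_mul, abs_of_nonneg (hw i hi)]
        exact mul_le_mul_of_nonneg_left (hf i hi) (hw i hi)
    _ = c := by rw [← sum_mul, hsum, one_mul]

/-- The finite maximum is nonexpansive for the sup distance. -/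
theorem abs_sup'_sub_sup'_le {ι : Type*} {s : Finset ι} (hs : s.Nonempty) (f g : ι → ℝ) (c : ℝ)
    (h : ∀ i ∈ s, |f i - g i| ≤ c) : |s.sup' hs f - s.sup' hs g| ≤ c := by
  have hfg : s.sup' hs f ≤ s.sup' hs g + c := sup'_le _ _ fun i hi => by
    linarith [(abs_le.mp (h i hi)).2, le_sup' g hi]
  have hgf : s.sup' hs g ≤ s.sup' hs f + c := sup'_le _ _ fun i hi => by
    linarith [(abs_le.mp (h i hi)).1, le_sup' f hi]
  exact abs_le.mpr ⟨by linarith, by linarith⟩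

/-- For a `φ_{Q*_ε}`-type approximate state abstraction, optimal `Q`-values
in the abstract MDP are within `ε / (1 - γ)` of the optimal `Q`-values of the ground MDP. -/
theorem stmt_0
    {S Sφ A : Type} [Fintype S] [Fintype Sφ] [Fintype A]
    [Nonempty S] [Nonempty Sφ] [Nonempty A] [DecidableEq Sφ]
    -- the ground MDP
    (R : S → A → ℝ) (T : S → A → S → ℝ) (γ RMax : ℝ)
    (hRMax : 0 < RMax)
    (hR : ∀ s a, 0 ≤ R s a ∧ R s a ≤ RMax)
    (hT0 : ∀ s a s', 0 ≤ T s a s')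
    (hT1 : ∀ s a, ∑ s', T s a s' = 1)
    (hγ0 : 0 ≤ γ) (hγ1 : γ < 1)
    -- optimal value functions of the ground MDP (the unique Bellman fixed point)
    (Qstar : S → A → ℝ) (Vstar : S → ℝ)
    (hVstar : ∀ s, Vstar s = univ.sup' univ_nonempty (fun a => Qstar s a))
    (hQstar : ∀ s a, Qstar s a = R s a + γ * ∑ s', T s a s' * Vstar s')
    -- the state abstraction and its weighting function
    (φ : S → Sφ) (hφ : Function.Surjective φ)
    (w : S → ℝ) (hw : ∀ s, 0 ≤ w s ∧ w s ≤ 1)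
    (hwsum : ∀ x : Sφ, ∑ s ∈ univ.filter (fun s => φ s = x), w s = 1)
    -- the induced abstract MDP
    (Rφ : Sφ → A → ℝ) (Tφ : Sφ → A → Sφ → ℝ)
    (hRφ : ∀ x a, Rφ x a = ∑ s ∈ univ.filter (fun s => φ s = x), w s * R s a)
    (hTφ : ∀ x a y, Tφ x a y =
      ∑ s ∈ univ.filter (fun s => φ s = x), w s *
        ∑ s' ∈ univ.filter (fun s' => φ s' = y), T s a s')
    -- optimal value functions of the abstract MDP (the unique Bellman fixed point)
    (Qφ : Sφ → A → ℝ) (Vφ : Sφ → ℝ)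
    (hVφ : ∀ x, Vφ x = univ.sup' univ_nonempty (fun a => Qφ x a))
    (hQφ : ∀ x a, Qφ x a = Rφ x a + γ * ∑ y, Tφ x a y * Vφ y)
    -- ε-similarity of optimal Q-values of co-aggregated states
    (ε : ℝ) (hε : 0 ≤ ε)
    (hsim : ∀ s₁ s₂, φ s₁ = φ s₂ → ∀ a, |Qstar s₁ a - Qstar s₂ a| ≤ ε) :
    ∀ s a, |Qstar s a - Qφ (φ s) a| ≤ ε / (1 - γ) := by
  have hQφ' : ∀ x a, Qφ x a = ∑ s ∈ univ.filter (fun s => φ s = x),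
      w s * (R s a + γ * ∑ s', T s a s' * Vφ (φ s')) := by
    intro x a
    have hnext : ∀ s, ∑ y, (∑ s' ∈ univ.filter (fun s' => φ s' = y), T s a s') * Vφ y =
        ∑ s', T s a s' * Vφ (φ s') := by
      intro s
      rw [← sum_fiberwise univ φ]
      refine sum_congr rfl fun y _ => ?_
      rw [sum_mul]
      refine sum_congr rfl fun s' hs' => ?_
      rw [(mem_filter.mp hs').2]
    have hT : ∑ y, Tφ x a y * Vφ y = ∑ s ∈ univ.filter (fun s => φ s = x),
        w s * ∑ s', T s a s' * Vφ (φ s') := by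
      simp_rw [hTφ, sum_mul, mul_assoc]
      rw [sum_comm]
      simp_rw [← mul_sum, hnext]
    rw [hQφ, hRφ, hT, mul_sum, ← sum_add_distrib]
    exact sum_congr rfl fun s _ => by ring
  obtain ⟨⟨s₀, a₀⟩, -, hmax⟩ := exists_max_image (univ : Finset (S × A))
    (fun p => |Qstar p.1 p.2 - Qφ (φ p.1) p.2|) univ_nonempty
  set D := |Qstar s₀ a₀ - Qφ (φ s₀) a₀| with hD
  have hQD : ∀ s a, |Qstar s a - Qφ (φ s) a| ≤ D := fun s a => hmax (s, a) (mem_univ _)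
  have hVD : ∀ s, |Vstar s - Vφ (φ s)| ≤ D := by
    intro s
    rw [hVstar, hVφ]
    exact abs_sup'_sub_sup'_le _ _ _ _ fun a _ => hQD s a
  have hstep : D ≤ ε + γ * D := by
    have hsplit : Qstar s₀ a₀ - Qφ (φ s₀) a₀ = ∑ s ∈ univ.filter (fun s => φ s = φ s₀),
        w s * ((Qstar s₀ a₀ - Qstar s a₀) +
          γ * ∑ s', T s a₀ s' * (Vstar s' - Vφ (φ s'))) := by
      have hconst : Qstar s₀ a₀ =
          ∑ s ∈ univ.filter (fun s => φ s = φ s₀), w s * Qstar s₀ a₀ := by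
        rw [← sum_mul, hwsum, one_mul]
      rw [hQφ']
      nth_rewrite 1 [hconst]
      rw [← sum_sub_distrib]
      refine sum_congr rfl fun s _ => ?_
      simp_rw [mul_sub (T s a₀ _), sum_sub_distrib]
      rw [hQstar s a₀]
      ring
    rw [hD, hsplit]
    refine abs_sum_mul_le_of_weights _ _ _ _ (fun s _ => (hw s).1) (hwsum _) fun s hs => ?_
    refine (abs_add_le _ _).trans (add_le_add (hsim _ _ (mem_filter.mp hs).2.symm _) ?_)
    rw [abs_mul, abs_of_nonneg hγ0, ← hsplit, ← hD]
    exact mul_le_mul_of_nonneg_left (abs_sum_mul_le_of_weights _ _ _ _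
      (fun s' _ => hT0 s a₀ s') (hT1 s a₀) fun s' _ => hVD s') hγ0
  intro s a
  refine (hQD s a).trans ?_
  rw [le_div_iff₀ (by linarith)]
  linarith
end

section
/- Let M = (S, A, R, T, γ) be a finite MDP and φ : S → S_φ a state abstraction with weighting function w. Suppose there is ε ≥ 0 such that whenever φ(s1) = φ(s2), |Q*(s1,a) − Q*(s2,a)| ≤ ε for every action a ∈ A. Then for every state s ∈ S, letting a*_φ be any maximizer of a ↦ Q*_φ(φ(s), a), the optimal abstract action is nearly optimal in the ground MDP: V*(s) ≤ Q*(s, a*_φ) + 2ε/(1−γ). -/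
open Finset

/-- A convex combination of points within `d` of `c` is within `d` of `c`. -/
theorem abs_sum_mul_sub_le {ι : Type*} (t : Finset ι) (w f : ι → ℝ) (c d : ℝ)
    (hw : ∀ i ∈ t, 0 ≤ w i) (hw1 : ∑ i ∈ t, w i = 1) (hf : ∀ i ∈ t, |f i - c| ≤ d) :
    |∑ i ∈ t, w i * f i - c| ≤ d := by
  have h : ∑ i ∈ t, w i * f i - c = ∑ i ∈ t, w i * (f i - c) := by
    simp only [mul_sub, sum_sub_distrib, ← sum_mul, hw1, one_mul]
  calc |∑ i ∈ t, w i * f i - c| ≤ ∑ i ∈ t, |w i * (f i - c)| := h ▸ abs_sum_le_sum_abs _ _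
    _ ≤ ∑ i ∈ t, w i * d := sum_le_sum fun i hi => by
        rw [abs_mul, abs_of_nonneg (hw i hi)]
        exact mul_le_mul_of_nonneg_left (hf i hi) (hw i hi)
    _ = d := by rw [← sum_mul, hw1, one_mul]

/-- Taking maxima over a finite set is nonexpansive. -/
theorem abs_sup'_sub_sup'_le_s1 {ι : Type*} (t : Finset ι) (ht : t.Nonempty) (f g : ι → ℝ) (d : ℝ)
    (h : ∀ i ∈ t, |f i - g i| ≤ d) : |t.sup' ht f - t.sup' ht g| ≤ d := by
  rw [abs_sub_le_iff, sub_le_iff_le_add, sub_le_iff_le_add]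
  constructor <;> refine sup'_le ht _ fun i hi => ?_
  · linarith [(abs_le.mp (h i hi)).2, le_sup' g hi]
  · linarith [(abs_le.mp (h i hi)).1, le_sup' f hi]

/-- For a `φ_{Q*_ε}`-type approximate state abstraction, any optimal action
of the abstract MDP has a ground `Q`-value that is `2ε/(1-γ)`-close to optimal. -/
theorem stmt_1
    {S Sφ A : Type} [Fintype S] [Fintype Sφ] [Fintype A]
    [Nonempty S] [Nonempty Sφ] [Nonempty A] [DecidableEq Sφ]
    -- the ground MDP
    (R : S → A → ℝ) (T : S → A → S → ℝ) (γ RMax : ℝ)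
    (hRMax : 0 < RMax)
    (hR : ∀ s a, 0 ≤ R s a ∧ R s a ≤ RMax)
    (hT0 : ∀ s a s', 0 ≤ T s a s')
    (hT1 : ∀ s a, ∑ s', T s a s' = 1)
    (hγ0 : 0 ≤ γ) (hγ1 : γ < 1)
    -- optimal value functions of the ground MDP (the unique Bellman fixed point)
    (Qstar : S → A → ℝ) (Vstar : S → ℝ)
    (hVstar : ∀ s, Vstar s = univ.sup' univ_nonempty (fun a => Qstar s a))
    (hQstar : ∀ s a, Qstar s a = R s a + γ * ∑ s', T s a s' * Vstar s')
    -- the state abstraction and its weighting function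
    (φ : S → Sφ) (hφ : Function.Surjective φ)
    (w : S → ℝ) (hw : ∀ s, 0 ≤ w s ∧ w s ≤ 1)
    (hwsum : ∀ x : Sφ, ∑ s ∈ univ.filter (fun s => φ s = x), w s = 1)
    -- the induced abstract MDP
    (Rφ : Sφ → A → ℝ) (Tφ : Sφ → A → Sφ → ℝ)
    (hRφ : ∀ x a, Rφ x a = ∑ s ∈ univ.filter (fun s => φ s = x), w s * R s a)
    (hTφ : ∀ x a y, Tφ x a y =
      ∑ s ∈ univ.filter (fun s => φ s = x), w s *
        ∑ s' ∈ univ.filter (fun s' => φ s' = y), T s a s')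
    -- optimal value functions of the abstract MDP (the unique Bellman fixed point)
    (Qφ : Sφ → A → ℝ) (Vφ : Sφ → ℝ)
    (hVφ : ∀ x, Vφ x = univ.sup' univ_nonempty (fun a => Qφ x a))
    (hQφ : ∀ x a, Qφ x a = Rφ x a + γ * ∑ y, Tφ x a y * Vφ y)
    -- ε-similarity of optimal Q-values of co-aggregated states
    (ε : ℝ) (hε : 0 ≤ ε)
    (hsim : ∀ s₁ s₂, φ s₁ = φ s₂ → ∀ a, |Qstar s₁ a - Qstar s₂ a| ≤ ε) :
    ∀ s : S, ∀ aφstar : A, (∀ a, Qφ (φ s) a ≤ Qφ (φ s) aφstar) →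
      Vstar s ≤ Qstar s aφstar + 2 * ε / (1 - γ) := by
  have hfiber : ∀ s a, ∑ y, (∑ s' ∈ univ.filter (fun s' => φ s' = y), T s a s') * Vφ y
      = ∑ s', T s a s' * Vφ (φ s') := by
    intro s a
    rw [← sum_fiberwise univ φ (fun s' => T s a s' * Vφ (φ s'))]
    refine sum_congr rfl fun y _ => ?_
    rw [sum_mul]
    refine sum_congr rfl fun s' hs' => ?_
    rw [(mem_filter.mp hs').2]
  have hQavg : ∀ x a, Qφ x a = ∑ s ∈ univ.filter (fun s => φ s = x),
      w s * (R s a + γ * ∑ s', T s a s' * Vφ (φ s')) := by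
    intro x a
    have h : ∑ y, Tφ x a y * Vφ y = ∑ s ∈ univ.filter (fun s => φ s = x),
        w s * ∑ s', T s a s' * Vφ (φ s') := by
      simp only [hTφ, sum_mul, ← hfiber]
      rw [sum_comm]
      simp only [mul_sum, sum_mul, mul_assoc]
    rw [hQφ, hRφ, h, mul_sum, ← sum_add_distrib]
    exact sum_congr rfl fun s _ => by ring
  obtain ⟨p, hp⟩ := Finite.exists_max fun p : S × A => |Qφ (φ p.1) p.2 - Qstar p.1 p.2|
  set e := |Qφ (φ p.1) p.2 - Qstar p.1 p.2|
  have hQ : ∀ s a, |Qφ (φ s) a - Qstar s a| ≤ e := fun s a => hp (s, a)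
  have hV : ∀ s, |Vφ (φ s) - Vstar s| ≤ e := fun s => by
    rw [hVφ, hVstar]
    exact abs_sup'_sub_sup'_le_s1 _ _ _ _ _ fun a _ => hQ s a
  have hbackup : ∀ s a, |R s a + γ * ∑ s', T s a s' * Vφ (φ s') - Qstar s a| ≤ γ * e := by
    intro s a
    have h : R s a + γ * ∑ s', T s a s' * Vφ (φ s') - Qstar s a
        = γ * (∑ s', T s a s' * (Vφ (φ s') - Vstar s') - 0) := by
      rw [hQstar]
      simp only [mul_sub, sum_sub_distrib]
      ring
    rw [h, abs_mul, abs_of_nonneg hγ0]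
    refine mul_le_mul_of_nonneg_left ?_ hγ0
    exact abs_sum_mul_sub_le _ _ _ _ _ (fun s' _ => hT0 s a s') (hT1 s a)
      fun s' _ => by simpa using hV s'
  have he : e ≤ γ * e + ε := by
    change |Qφ (φ p.1) p.2 - Qstar p.1 p.2| ≤ _
    rw [hQavg]
    refine abs_sum_mul_sub_le _ _ _ _ _ (fun s _ => (hw s).1) (hwsum _) fun s hs => ?_
    exact (abs_sub_le _ (Qstar s p.2) _).trans
      (add_le_add (hbackup s p.2) (hsim _ _ (mem_filter.mp hs).2 _))
  have he' : e ≤ ε / (1 - γ) := by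
    rw [le_div_iff₀ (by linarith)]
    linarith
  intro s b hb
  rw [hVstar, mul_div_assoc]
  refine sup'_le _ _ fun a _ => ?_
  linarith [(abs_le.mp (hQ s a)).1, (abs_le.mp (hQ s b)).2, hb a]
end

section
/- Let M = (S, A, R, T, γ) be a finite MDP and φ : S → S_φ a state abstraction with weighting function w. Suppose there are ε_R, ε_T ≥ 0 such that whenever φ(s1) = φ(s2): for every action a, |R(s1,a) − R(s2,a)| ≤ ε_R, and for every abstract state y ∈ S_φ, Σ_{s' : φ(s')=y} |T(s'|s1,a) − T(s'|s2,a)| ≤ ε_T. Then (i) co-aggregated states have similar optimal action values: whenever φ(s1)=φ(s2), for all a, |Q*(s1,a) − Q*(s2,a)| ≤ ε_R + γ·|S_φ|·ε_T·RMax/(1−γ); and (ii) for an optimal deterministic policy π*_φ of M_φ, for every state s, V*(s) − V^{π*_φ∘φ}(s) ≤ 2(ε_R + γ·|S_φ|·ε_T·RMax/(1−γ))/(1−γ)². -/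
open Finset

/-- If a function on a finite type satisfies the contraction estimate `f ≤ c + γ M` for every
upper bound `M`, then it is bounded by `c / (1 - γ)`. -/
theorem le_div_one_sub_of_contraction {S : Type*} [Finite S] (f : S → ℝ) {c γ : ℝ} (hγ : γ < 1)
    (h : ∀ M, (∀ s, f s ≤ M) → ∀ s, f s ≤ c + γ * M) (s : S) : f s ≤ c / (1 - γ) := by
  have : Nonempty S := ⟨s⟩
  obtain ⟨m, hm⟩ := Finite.exists_max f
  have hc := h (f m) hm m
  rw [le_div_iff₀ (by linarith)]
  nlinarith [hm s]

theorem weighted_sum_le {ι : Type*} (u : Finset ι) (p f : ι → ℝ) {c : ℝ}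
    (hp : ∀ i ∈ u, 0 ≤ p i) (hp1 : ∑ i ∈ u, p i = 1) (hf : ∀ i ∈ u, f i ≤ c) :
    ∑ i ∈ u, p i * f i ≤ c := by
  calc ∑ i ∈ u, p i * f i ≤ ∑ i ∈ u, p i * c :=
        sum_le_sum fun i hi => mul_le_mul_of_nonneg_left (hf i hi) (hp i hi)
    _ = c := by rw [← sum_mul, hp1, one_mul]

theorem abs_weighted_sum_le {ι : Type*} (u : Finset ι) (p f : ι → ℝ) {c : ℝ}
    (hp : ∀ i ∈ u, 0 ≤ p i) (hp1 : ∑ i ∈ u, p i = 1) (hf : ∀ i ∈ u, |f i| ≤ c) :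
    |∑ i ∈ u, p i * f i| ≤ c := by
  refine (abs_sum_le_sum_abs _ _).trans ?_
  rw [sum_congr rfl fun i hi => by rw [abs_mul, abs_of_nonneg (hp i hi)]]
  exact weighted_sum_le u p (fun i => |f i|) hp hp1 hf

theorem abs_sup'_sub_sup'_le_s3 {A : Type*} [Fintype A] [Nonempty A] (f g : A → ℝ) {c : ℝ}
    (h : ∀ a, |f a - g a| ≤ c) :
    |univ.sup' univ_nonempty f - univ.sup' univ_nonempty g| ≤ c := by
  rw [abs_sub_le_iff, sub_le_iff_le_add, sub_le_iff_le_add]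
  constructor <;> refine sup'_le _ _ fun a _ => ?_
  · linarith [(abs_sub_le_iff.1 (h a)).1, le_sup' g (mem_univ a)]
  · linarith [(abs_sub_le_iff.1 (h a)).2, le_sup' f (mem_univ a)]

/-- For a `φ_{model,ε}`-type approximate state abstraction, co-aggregated
states have similar optimal action values, and the optimal abstract policy, applied in the
ground MDP, has bounded value loss. -/
theorem stmt_3
    {S Sφ A : Type} [Fintype S] [Fintype Sφ] [Fintype A]
    [Nonempty S] [Nonempty Sφ] [Nonempty A] [DecidableEq Sφ]
    -- the ground MDP
    (R : S → A → ℝ) (T : S → A → S → ℝ) (γ RMax : ℝ)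
    (hRMax : 0 < RMax)
    (hR : ∀ s a, 0 ≤ R s a ∧ R s a ≤ RMax)
    (hT0 : ∀ s a s', 0 ≤ T s a s')
    (hT1 : ∀ s a, ∑ s', T s a s' = 1)
    (hγ0 : 0 ≤ γ) (hγ1 : γ < 1)
    -- optimal value functions of the ground MDP (the unique Bellman fixed point)
    (Qstar : S → A → ℝ) (Vstar : S → ℝ)
    (hVstar : ∀ s, Vstar s = univ.sup' univ_nonempty (fun a => Qstar s a))
    (hQstar : ∀ s a, Qstar s a = R s a + γ * ∑ s', T s a s' * Vstar s')
    -- the state abstraction and its weighting function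
    (φ : S → Sφ) (hφ : Function.Surjective φ)
    (w : S → ℝ) (hw : ∀ s, 0 ≤ w s ∧ w s ≤ 1)
    (hwsum : ∀ x : Sφ, ∑ s ∈ univ.filter (fun s => φ s = x), w s = 1)
    -- the induced abstract MDP
    (Rφ : Sφ → A → ℝ) (Tφ : Sφ → A → Sφ → ℝ)
    (hRφ : ∀ x a, Rφ x a = ∑ s ∈ univ.filter (fun s => φ s = x), w s * R s a)
    (hTφ : ∀ x a y, Tφ x a y =
      ∑ s ∈ univ.filter (fun s => φ s = x), w s *
        ∑ s' ∈ univ.filter (fun s' => φ s' = y), T s a s')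
    -- optimal value functions of the abstract MDP (the unique Bellman fixed point)
    (Qφ : Sφ → A → ℝ) (Vφ : Sφ → ℝ)
    (hVφ : ∀ x, Vφ x = univ.sup' univ_nonempty (fun a => Qφ x a))
    (hQφ : ∀ x a, Qφ x a = Rφ x a + γ * ∑ y, Tφ x a y * Vφ y)
    -- ε-similarity of the one-step models of co-aggregated states
    (εR εT : ℝ) (hεR : 0 ≤ εR) (hεT : 0 ≤ εT)
    (hsimR : ∀ s₁ s₂, φ s₁ = φ s₂ → ∀ a, |R s₁ a - R s₂ a| ≤ εR)
    (hsimT : ∀ s₁ s₂, φ s₁ = φ s₂ → ∀ a, ∀ y : Sφ,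
      ∑ s' ∈ univ.filter (fun s' => φ s' = y), |T s₁ a s' - T s₂ a s'| ≤ εT)
    -- an optimal deterministic policy of the abstract MDP
    (πφ : Sφ → A) (hπφ : ∀ x, Qφ x (πφ x) = Vφ x)
    -- the ground value function of the induced ground policy `πφ ∘ φ`
    (Vπ : S → ℝ)
    (hVπ : ∀ s, Vπ s = R s (πφ (φ s)) + γ * ∑ s', T s (πφ (φ s)) s' * Vπ s') :
    (∀ s₁ s₂, φ s₁ = φ s₂ → ∀ a,
      |Qstar s₁ a - Qstar s₂ a| ≤ εR + γ * (Fintype.card Sφ : ℝ) * εT * RMax / (1 - γ)) ∧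
    (∀ s, Vstar s - Vπ s ≤
      2 * (εR + γ * (Fintype.card Sφ : ℝ) * εT * RMax / (1 - γ)) / (1 - γ) ^ 2) := by
  have hγ' : 0 < 1 - γ := by linarith
  have hQV : ∀ s a, Qstar s a ≤ Vstar s := fun s a => by
    rw [hVstar]; exact le_sup' (fun a => Qstar s a) (mem_univ a)
  have hVub : ∀ s, Vstar s ≤ RMax / (1 - γ) := by
    refine le_div_one_sub_of_contraction Vstar hγ1 fun M hM s => ?_
    rw [hVstar]
    refine sup'_le _ _ fun a _ => ?_
    rw [hQstar]
    exact add_le_add (hR s a).2 (mul_le_mul_of_nonneg_left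
      (weighted_sum_le univ _ _ (fun i _ => hT0 s a i) (hT1 s a) fun i _ => hM i) hγ0)
  have hVlb : ∀ s, 0 ≤ Vstar s := by
    intro s
    have h := le_div_one_sub_of_contraction (c := 0) (fun s => -Vstar s) hγ1 (fun M hM s => ?_) s
    · rw [zero_div] at h; linarith
    · obtain ⟨a⟩ := ‹Nonempty A›
      have hQ := hQV s a
      rw [hQstar] at hQ
      have hle := mul_le_mul_of_nonneg_left
        (weighted_sum_le univ _ _ (fun i _ => hT0 s a i) (hT1 s a) fun i _ => hM i) hγ0
      simp only [mul_neg, sum_neg_distrib] at hle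
      linarith [(hR s a).1]
  have hTl1 : ∀ s₁ s₂, φ s₁ = φ s₂ → ∀ a,
      ∑ s', |T s₁ a s' - T s₂ a s'| ≤ Fintype.card Sφ * εT := by
    intro s₁ s₂ h a
    rw [← sum_fiberwise univ φ]
    refine (sum_le_sum fun y _ => hsimT s₁ s₂ h a y).trans ?_
    simp
  have hsim : ∀ s₁ s₂, φ s₁ = φ s₂ → ∀ a,
      |Qstar s₁ a - Qstar s₂ a| ≤ εR + γ * (Fintype.card Sφ : ℝ) * εT * RMax / (1 - γ) := by
    intro s₁ s₂ h a
    have hdiff : Qstar s₁ a - Qstar s₂ a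
        = (R s₁ a - R s₂ a) + γ * ∑ s', (T s₁ a s' - T s₂ a s') * Vstar s' := by
      rw [hQstar, hQstar]; simp only [sub_mul, sum_sub_distrib]; ring
    have hsum : |∑ s', (T s₁ a s' - T s₂ a s') * Vstar s'|
        ≤ Fintype.card Sφ * εT * (RMax / (1 - γ)) := by
      calc |∑ s', (T s₁ a s' - T s₂ a s') * Vstar s'|
          ≤ ∑ s', |T s₁ a s' - T s₂ a s'| * (RMax / (1 - γ)) := by
            refine (abs_sum_le_sum_abs _ _).trans (sum_le_sum fun s' _ => ?_)
            rw [abs_mul, abs_of_nonneg (hVlb s')]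
            exact mul_le_mul_of_nonneg_left (hVub s') (abs_nonneg _)
        _ ≤ _ := by
            rw [← sum_mul]
            exact mul_le_mul_of_nonneg_right (hTl1 s₁ s₂ h a) (by positivity)
    rw [hdiff]
    calc _ ≤ |R s₁ a - R s₂ a| + γ * |∑ s', (T s₁ a s' - T s₂ a s') * Vstar s'| := by
          refine (abs_add_le _ _).trans_eq ?_
          rw [abs_mul, abs_of_nonneg hγ0]
      _ ≤ εR + γ * (Fintype.card Sφ * εT * (RMax / (1 - γ))) :=
          add_le_add (hsimR s₁ s₂ h a) (mul_le_mul_of_nonneg_left hsum hγ0)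
      _ = _ := by ring
  refine ⟨hsim, ?_⟩
  set Δ := εR + γ * (Fintype.card Sφ : ℝ) * εT * RMax / (1 - γ)
  have hQavg : ∀ x a, Qφ x a = ∑ s ∈ univ.filter (fun s => φ s = x),
      w s * (R s a + γ * ∑ s', T s a s' * Vφ (φ s')) := by
    intro x a
    have hpush : ∀ s, ∑ s', T s a s' * Vφ (φ s')
        = ∑ y, (∑ s' ∈ univ.filter (fun s' => φ s' = y), T s a s') * Vφ y := by
      intro s
      rw [← sum_fiberwise univ φ]
      refine sum_congr rfl fun y _ => ?_
      rw [sum_mul]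
      exact sum_congr rfl fun s' hs' => by rw [(mem_filter.1 hs').2]
    rw [hQφ, hRφ]
    simp only [hTφ, hpush, mul_add, sum_add_distrib, sum_mul (univ.filter fun s => φ s = x)]
    rw [sum_comm, mul_sum]
    congr 1
    refine sum_congr rfl fun s _ => ?_
    simp only [mul_sum (univ : Finset Sφ)]
    exact sum_congr rfl fun y _ => by ring
  have hQstep : ∀ M, (∀ s, |Vφ (φ s) - Vstar s| ≤ M) →
      ∀ s a, |Qφ (φ s) a - Qstar s a| ≤ Δ + γ * M := by
    intro M hM s a
    have hcenter : Qφ (φ s) a - Qstar s a = ∑ t ∈ univ.filter (fun t => φ t = φ s),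
        w t * (R t a + γ * ∑ s', T t a s' * Vφ (φ s') - Qstar s a) := by
      simp only [mul_sub, sum_sub_distrib]
      rw [← sum_mul, hwsum, one_mul, ← hQavg]
    rw [hcenter]
    refine abs_weighted_sum_le _ _ _ (fun t _ => (hw t).1) (hwsum _) fun t ht => ?_
    have hsplit : R t a + γ * ∑ s', T t a s' * Vφ (φ s') - Qstar s a
        = (Qstar t a - Qstar s a) + γ * ∑ s', T t a s' * (Vφ (φ s') - Vstar s') := by
      rw [hQstar t]; simp only [mul_sub, sum_sub_distrib]; ring
    rw [hsplit]
    refine (abs_add_le _ _).trans (add_le_add (hsim t s (mem_filter.1 ht).2 a) ?_)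
    rw [abs_mul, abs_of_nonneg hγ0]
    exact mul_le_mul_of_nonneg_left
      (abs_weighted_sum_le univ _ _ (fun i _ => hT0 t a i) (hT1 t a) fun i _ => hM i) hγ0
  have hVclose : ∀ s, |Vφ (φ s) - Vstar s| ≤ Δ / (1 - γ) := by
    refine le_div_one_sub_of_contraction (fun s => |Vφ (φ s) - Vstar s|) hγ1 fun M hM s => ?_
    simp only [hVφ, hVstar s]
    exact abs_sup'_sub_sup'_le_s3 _ _ (hQstep M hM s)
  have hQclose : ∀ s a, |Qφ (φ s) a - Qstar s a| ≤ Δ / (1 - γ) := by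
    intro s a
    refine (hQstep _ hVclose s a).trans_eq ?_
    field_simp
    ring
  intro s
  have hloss := le_div_one_sub_of_contraction (c := 2 * (Δ / (1 - γ)))
    (fun s => Vstar s - Vπ s) hγ1 (fun M hM s => ?_) s
  · refine hloss.trans_eq ?_
    field_simp
  · have hgap : Vstar s - Qstar s (πφ (φ s)) ≤ 2 * (Δ / (1 - γ)) := by
      have h₁ := (abs_le.1 (hVclose s)).1
      have h₂ := (abs_le.1 (hQclose s (πφ (φ s)))).2
      rw [hπφ] at h₂
      linarith
    have hle := mul_le_mul_of_nonneg_left (weighted_sum_le univ _ _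
      (fun i _ => hT0 s (πφ (φ s)) i) (hT1 s (πφ (φ s))) fun i _ => hM i) hγ0
    simp only [mul_sub, sum_sub_distrib] at hle
    rw [hQstar] at hgap
    have := hVπ s
    linarith
end

section
/- Let S and A be finite nonempty sets, f : S × A → ℝ, and d > 0. Suppose 𝒫 is a partition of S such that every cell C ∈ 𝒫 satisfies |f(s1,a) − f(s2,a)| ≤ d for all s1, s2 ∈ C and all a ∈ A. Define the bucket map b : S → ℤ^A by b(s)(a) = ⌈f(s,a)/d⌉. Then the number of distinct bucket vectors satisfies |b(S)| ≤ 2^{|A|} · |𝒫|. In particular, the partition of S that aggregates two states exactly when they have the same bucket vector has at most 2^{|A|} times as many cells as any partition of S into d-similar cells. -/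
open Finset

/-- If every `f · a` varies by at most `d` on `C`, then the bucket vectors of the points of `C`
take at most `2 ^ |A|` values. -/
theorem card_image_ceil_div_le_two_pow {S A : Type*} [Fintype A] [DecidableEq A]
    (f : S → A → ℝ) {d : ℝ} (hd : 0 < d) (C : Finset S)
    (hC : ∀ s₁ ∈ C, ∀ s₂ ∈ C, ∀ a, |f s₁ a - f s₂ a| ≤ d) :
    (C.image (fun s => (fun a => (⌈f s a / d⌉ : ℤ)))).card ≤ 2 ^ Fintype.card A := by
  rcases C.eq_empty_or_nonempty with rfl | hne
  · simp
  choose m hmC hm using fun a => C.exists_min_image (fun s => f s a) hne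
  have hsub : C.image (fun s => (fun a => (⌈f s a / d⌉ : ℤ))) ⊆
      Fintype.piFinset fun a => Finset.Icc ⌈f (m a) a / d⌉ (⌈f (m a) a / d⌉ + 1) := by
    refine Finset.image_subset_iff.2 fun s hs => Fintype.mem_piFinset.2 fun a => ?_
    refine Finset.mem_Icc.2 ⟨Int.ceil_mono (by gcongr; exact hm a s hs), ?_⟩
    rw [← Int.ceil_add_one]
    refine Int.ceil_mono ?_
    rw [div_add_one hd.ne']
    gcongr
    linarith [le_of_abs_le (hC s hs (m a) (hmC a) a)]
  refine (Finset.card_le_card hsub).trans_eq ?_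
  simp [Fintype.card_piFinset, add_assoc]

/-- (Combinatorial content of Theorem on the size loss of transitive
abstractions.)  If `𝒫` is a partition of a finite set `S` into cells on which
`f(·,a)` varies by at most `d` for every action `a`, then the number of distinct bucket
vectors `a ↦ ⌈f(s,a)/d⌉` is at most `2^{|A|} · |𝒫|`. -/
theorem stmt_6
    {S A : Type} [Fintype S] [Fintype A] [Nonempty S] [Nonempty A]
    [DecidableEq S] [DecidableEq A]
    (f : S → A → ℝ) (d : ℝ) (hd : 0 < d)
    (P : Finpartition (Finset.univ : Finset S))
    (hP : ∀ C ∈ P.parts, ∀ s₁ ∈ C, ∀ s₂ ∈ C, ∀ a, |f s₁ a - f s₂ a| ≤ d) :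
    (Finset.univ.image (fun s => (fun a => (⌈f s a / d⌉ : ℤ)))).card
      ≤ 2 ^ (Fintype.card A) * P.parts.card := by
  rw [← congrArg (Finset.image _) P.biUnion_parts, Finset.biUnion_image, mul_comm]
  exact Finset.card_biUnion_le_card_mul _ _ _ fun C hC =>
    card_image_ceil_div_le_two_pow f hd C (hP C hC)
end

section
/- Fix finite state and action sets S, A, transition probabilities T, a discount γ ∈ (0,1), and a start state s0. Let π1 and π2 be stochastic stationary policies with sup_{s∈S} Σ_{a∈A} |π1(a|s) − π2(a|s)| ≤ Δ for some Δ ≥ 0. Then for every t ≥ 0, the t-step state distributions satisfy Σ_{s∈S} |ρ^t_{π1,s0}(s) − ρ^t_{π2,s0}(s)| ≤ t·Δ. -/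
open Finset

/-- The `t`-step state distribution of a stochastic stationary policy `π` started at `s0`:
`ρ⁰ = δ_{s0}` and `ρ^{t+1}(s') = Σ_s ρ^t(s) Σ_a π(a|s) T(s'|s,a)`. -/
noncomputable def stepDist {S A : Type} [Fintype S] [Fintype A] [DecidableEq S]
    (T : S → A → S → ℝ) (π : S → A → ℝ) (s0 : S) : ℕ → S → ℝ
  | 0 => fun s => if s = s0 then 1 else 0
  | t + 1 => fun s' => ∑ s, stepDist T π s0 t s * ∑ a, π s a * T s a s'

/-- A kernel whose rows have `L¹` norm at most `c` has `L¹` operator norm at most `c`. -/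
theorem sum_abs_sum_mul_le {I J : Type*} [Fintype I] [Fintype J]
    (v : I → ℝ) (K : I → J → ℝ) {c : ℝ} (hK : ∀ i, ∑ j, |K i j| ≤ c) :
    ∑ j, |∑ i, v i * K i j| ≤ (∑ i, |v i|) * c := by
  calc ∑ j, |∑ i, v i * K i j|
      ≤ ∑ j, ∑ i, |v i| * |K i j| := by
        gcongr with j
        simpa only [abs_mul] using abs_sum_le_sum_abs (fun i => v i * K i j) univ
    _ = ∑ i, |v i| * ∑ j, |K i j| := by
        rw [sum_comm]
        simp only [mul_sum]
    _ ≤ ∑ i, |v i| * c := by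
        gcongr with i
        exact hK i
    _ = (∑ i, |v i|) * c := (sum_mul ..).symm

theorem sum_abs_stepDist_le_one {S A : Type} [Fintype S] [Fintype A] [DecidableEq S]
    {T : S → A → S → ℝ} {π : S → A → ℝ}
    (hK : ∀ s, ∑ s', |∑ a, π s a * T s a s'| ≤ 1) (s0 : S) (t : ℕ) :
    ∑ s, |stepDist T π s0 t s| ≤ 1 := by
  induction t with
  | zero => simp [stepDist, apply_ite abs]
  | succ t ih =>
    simpa only [stepDist, mul_one] using (sum_abs_sum_mul_le _ _ hK).trans (by simpa using ih)

/-- If two stochastic stationary policies are `Δ`-close in total policy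
deviation at every state, then their `t`-step state distributions are `t·Δ`-close in `L¹`. -/
theorem stmt_8
    {S A : Type} [Fintype S] [Fintype A] [Nonempty S] [Nonempty A] [DecidableEq S]
    (T : S → A → S → ℝ)
    (hT0 : ∀ s a s', 0 ≤ T s a s') (hT1 : ∀ s a, ∑ s', T s a s' = 1)
    (γ : ℝ) (hγ0 : 0 < γ) (hγ1 : γ < 1)
    (s0 : S)
    (π₁ π₂ : S → A → ℝ)
    (hπ₁0 : ∀ s a, 0 ≤ π₁ s a) (hπ₁1 : ∀ s, ∑ a, π₁ s a = 1)
    (hπ₂0 : ∀ s a, 0 ≤ π₂ s a) (hπ₂1 : ∀ s, ∑ a, π₂ s a = 1)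
    (Δ : ℝ) (hΔ0 : 0 ≤ Δ)
    (hΔ : ∀ s, ∑ a, |π₁ s a - π₂ s a| ≤ Δ) :
    ∀ t : ℕ, ∑ s, |stepDist T π₁ s0 t s - stepDist T π₂ s0 t s| ≤ (t : ℝ) * Δ := by
  have hT : ∀ s a, ∑ s', |T s a s'| ≤ 1 := fun s a => by
    simp only [abs_of_nonneg (hT0 s a _), hT1, le_refl]
  have hK (π : S → A → ℝ) (h0 : ∀ s a, 0 ≤ π s a) (h1 : ∀ s, ∑ a, π s a = 1) (s : S) :
      ∑ s', |∑ a, π s a * T s a s'| ≤ 1 := by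
    simpa only [abs_of_nonneg (h0 s _), h1, mul_one] using sum_abs_sum_mul_le (π s) (T s) (hT s)
  have hD (s : S) : ∑ s', |∑ a, (π₁ s a - π₂ s a) * T s a s'| ≤ Δ :=
    (sum_abs_sum_mul_le _ _ (hT s)).trans (by simpa using hΔ s)
  intro t
  induction t with
  | zero => simp [stepDist]
  | succ t ih =>
    have hsplit (s' : S) : stepDist T π₁ s0 (t + 1) s' - stepDist T π₂ s0 (t + 1) s' =
        (∑ s, (stepDist T π₁ s0 t s - stepDist T π₂ s0 t s) * ∑ a, π₁ s a * T s a s') +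
          ∑ s, stepDist T π₂ s0 t s * ∑ a, (π₁ s a - π₂ s a) * T s a s' := by
      simp only [stepDist, sub_mul, sum_sub_distrib, mul_sub]
      ring
    calc ∑ s', |stepDist T π₁ s0 (t + 1) s' - stepDist T π₂ s0 (t + 1) s'|
        ≤ (∑ s', |∑ s, (stepDist T π₁ s0 t s - stepDist T π₂ s0 t s) *
              ∑ a, π₁ s a * T s a s'|) +
            ∑ s', |∑ s, stepDist T π₂ s0 t s * ∑ a, (π₁ s a - π₂ s a) * T s a s'| := by
          rw [← sum_add_distrib]
          gcongr with s'
          rw [hsplit]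
          exact abs_add_le _ _
      _ ≤ (∑ s, |stepDist T π₁ s0 t s - stepDist T π₂ s0 t s|) * 1 +
            (∑ s, |stepDist T π₂ s0 t s|) * Δ :=
          add_le_add (sum_abs_sum_mul_le _ _ (hK π₁ hπ₁0 hπ₁1)) (sum_abs_sum_mul_le _ _ hD)
      _ ≤ (t * Δ) * 1 + 1 * Δ := by
          gcongr
          exact sum_abs_stepDist_le_one (hK π₂ hπ₂0 hπ₂1) s0 t
      _ = ((t + 1 : ℕ) : ℝ) * Δ := by
          push_cast
          ring
end

section
/- Let M = (S, A, R, T, γ) be a finite MDP, φ : S → S_φ a state abstraction, and O_φ an admissible set of φ-relative options. Suppose there is ε_Q ≥ 0 such that for every abstract state x ∈ S_φ there exists an option o ∈ O_φ for x with max_{s : φ(s)=x} |Q*_x(s, o*_x) − Q*_x(s, o)| ≤ ε_Q. Then the value loss satisfies L(φ, O_φ) ≤ ε_Q/(1−γ). -/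
open Finset

/-- A discounted average of values bounded by `B` is at most `γ * B`. -/
theorem mul_sum_mul_le_of_le {S : Type*} [Fintype S] {w g : S → ℝ} {γ B : ℝ} (hγ : 0 ≤ γ)
    (hw : ∀ s, 0 ≤ w s) (hw1 : ∑ s, w s = 1) (hg : ∀ s, g s ≤ B) :
    γ * ∑ s, w s * g s ≤ γ * B := by
  refine mul_le_mul_of_nonneg_left ?_ hγ
  calc ∑ s, w s * g s ≤ ∑ s, w s * B := by gcongr with s; exacts [hw s, hg s]
    _ = B := by rw [← sum_mul, hw1, one_mul]

/-- (Value loss of the `O_{φ,Q*_ε}` class of `φ`-relative options.)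
If every abstract state has an option whose `Q*`-value is `ε_Q`-close to that of the optimal
option, then the value loss of `(φ, O_φ)` is at most `ε_Q/(1-γ)`. -/
theorem stmt_11
    {S A Sφ : Type} [Fintype S] [Fintype A] [Fintype Sφ]
    [Nonempty S] [Nonempty A] [Nonempty Sφ] [DecidableEq Sφ]
    -- the ground MDP
    (R : S → A → ℝ) (T : S → A → S → ℝ) (γ RMax : ℝ)
    (hRMax : 0 < RMax)
    (hR : ∀ s a, 0 ≤ R s a ∧ R s a ≤ RMax)
    (hT0 : ∀ s a s', 0 ≤ T s a s')
    (hT1 : ∀ s a, ∑ s', T s a s' = 1)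
    (hγ0 : 0 ≤ γ) (hγ1 : γ < 1)
    -- optimal value functions of the ground MDP (the unique Bellman fixed point)
    (Qstar : S → A → ℝ) (Vstar : S → ℝ)
    (hVstar : ∀ s, Vstar s = univ.sup' univ_nonempty (fun a => Qstar s a))
    (hQstar : ∀ s a, Qstar s a = R s a + γ * ∑ s', T s a s' * Vstar s')
    -- the state abstraction
    (φ : S → Sφ) (hφ : Function.Surjective φ)
    -- an admissible set of φ-relative options: for each abstract state `x`, a nonempty set
    -- of ground policies (the policies of the options initiating exactly in the block of `x`)
    (Opts : Sφ → Set (S → A)) (hadm : ∀ x, (Opts x).Nonempty)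
    -- `Qx x o s`: expected return of running option `o` from `s` until it exits the block of
    -- `x`, and acting optimally thereafter (the unique fixed point of the equation below)
    (Qx : Sφ → (S → A) → S → ℝ)
    (hQx : ∀ x (o : S → A) (s : S), Qx x o s = R s (o s) + γ * ∑ s', T s (o s) s' *
        (if φ s' = x then Qx x o s' else Vstar s'))
    -- an optimal policy of the ground MDP; the optimal option `o*_x` follows it in the block
    (πstar : S → A) (hπstar : ∀ s, Qstar s (πstar s) = Vstar s)
    -- the ground value function of any deterministic ground policy
    (Vpol : (S → A) → S → ℝ)
    (hVpol : ∀ (p : S → A) (s : S), Vpol p s = R s (p s) + γ * ∑ s', T s (p s) s' * Vpol p s')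
    -- every abstract state has an option that is ε_Q-close in Q*-value to the optimal option
    (εQ : ℝ) (hεQ : 0 ≤ εQ)
    (hopt : ∀ x : Sφ, ∃ o ∈ Opts x, ∀ s, φ s = x → |Qx x πstar s - Qx x o s| ≤ εQ) :
    -- the value loss L(φ, O_φ) = min over assignments of the worst-case ground loss
    -- is at most εQ/(1-γ):
    ∃ μ : Sφ → (S → A), (∀ x, μ x ∈ Opts x) ∧
      ∀ s, Vstar s - Vpol (fun s' => μ (φ s') s') s ≤ εQ / (1 - γ) := by
  have hle : ∀ x s, Vstar s ≤ Qx x πstar s := by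
    intro x
    obtain ⟨m, hm⟩ := Finite.exists_max (fun s => Vstar s - Qx x πstar s)
    have hrec : Vstar m - Qx x πstar m = γ * ∑ s', T m (πstar m) s' *
        (if φ s' = x then Vstar s' - Qx x πstar s' else 0) := by
      conv_lhs => rw [← hπstar m, hQstar, hQx, add_sub_add_left_eq_sub, ← mul_sub,
        ← sum_sub_distrib]
      congr 1
      refine sum_congr rfl fun s' _ => ?_
      split_ifs <;> ring
    have hbound := mul_sum_mul_le_of_le (B := max (Vstar m - Qx x πstar m) 0)
      (g := fun s' => if φ s' = x then Vstar s' - Qx x πstar s' else 0)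
      hγ0 (hT0 m (πstar m)) (hT1 m (πstar m)) (fun s' => by
        split_ifs
        · exact le_max_of_le_left (hm s')
        · exact le_max_right _ _)
    rw [← hrec] at hbound
    intro s
    have hs := hm s
    rcases max_cases (Vstar m - Qx x πstar m) 0 with ⟨h, _⟩ | ⟨h, _⟩ <;> rw [h] at hbound <;>
      nlinarith
  choose μ hμ hclose using hopt
  refine ⟨μ, hμ, ?_⟩
  set p : S → A := fun s => μ (φ s) s with hp
  set q : S → ℝ := fun s => Qx (φ s) (μ (φ s)) s with hq
  have hnear : ∀ s, Vstar s - q s ≤ εQ := fun s => by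
    have := (abs_le.mp (hclose (φ s) s rfl)).2
    linarith [hle (φ s) s]
  obtain ⟨d, hd⟩ := Finite.exists_max (fun s => Vstar s - Vpol p s)
  obtain ⟨e, he⟩ := Finite.exists_max (fun s => q s - Vpol p s)
  have hrec : q e - Vpol p e = γ * ∑ s', T e (p e) s' *
      (if φ s' = φ e then q s' - Vpol p s' else Vstar s' - Vpol p s') := by
    conv_lhs => rw [hq, hVpol]
    dsimp only
    rw [hQx, add_sub_add_left_eq_sub, ← mul_sub, ← sum_sub_distrib]
    congr 1
    refine sum_congr rfl fun s' _ => ?_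
    split_ifs with h
    · simp only [hq, hp, h]
      ring
    · ring
  have hbound := mul_sum_mul_le_of_le (B := max (q e - Vpol p e) (Vstar d - Vpol p d))
    (g := fun s' => if φ s' = φ e then q s' - Vpol p s' else Vstar s' - Vpol p s')
    hγ0 (hT0 e (p e)) (hT1 e (p e)) (fun s' => by
      split_ifs
      · exact le_max_of_le_left (he s')
      · exact le_max_of_le_right (hd s'))
  rw [← hrec] at hbound
  intro s
  rw [le_div_iff₀ (by linarith)]
  have hmax : (Vstar d - Vpol p d) * (1 - γ) ≤ εQ := by
    have h1 := hnear d
    have h2 := he d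
    rcases max_cases (q e - Vpol p e) (Vstar d - Vpol p d) with ⟨h, _⟩ | ⟨h, _⟩ <;>
      rw [h] at hbound <;> nlinarith
  exact (mul_le_mul_of_nonneg_right (hd s) (by linarith)).trans hmax
end

section
/- Let M = (S, A, R, T, γ) be a finite MDP, φ : S → S_φ a state abstraction, and O_φ an admissible set of φ-relative options. Suppose there are ε_T, ε_R ≥ 0 such that for every abstract state x ∈ S_φ there exists an option o ∈ O_φ for x whose multi-time model is close to that of the optimal option: for all s ∈ φ⁻¹(x), max_{s'∈S} |T_o(s'|s, o*_x) − T_o(s'|s, o)| ≤ ε_T and |R_o(s, o*_x) − R_o(s, o)| ≤ ε_R. Then the value loss satisfies L(φ, O_φ) ≤ (ε_R + |S|·ε_T·RMax)/(1−γ)². -/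
open Finset

/-- Maximum principle for a nonnegative kernel with row sums at most `γ < 1`, on a subset `P`. -/
theorem le_div_of_le_add_sum_kernel {S : Type} [Fintype S] (P : S → Prop) [DecidablePred P]
    (L : S → S → ℝ) (γ c : ℝ) (hγ1 : γ < 1) (hc : 0 ≤ c) (hL0 : ∀ s s', P s → 0 ≤ L s s')
    (hL1 : ∀ s, P s → ∑ s', L s s' ≤ γ) (f : S → ℝ)
    (hf : ∀ s, P s → f s ≤ c + ∑ s', L s s' * (if P s' then f s' else 0)) :
    ∀ s, P s → f s ≤ c / (1 - γ) := by
  intro s hs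
  obtain ⟨m, hm, hmax⟩ := exists_max_image (univ.filter P) f ⟨s, by simpa using hs⟩
  have hPm : P m := by simpa using hm
  have hsm : f s ≤ f m := hmax s (by simpa using hs)
  have hpos : 0 < 1 - γ := by linarith
  refine hsm.trans ?_
  rcases le_or_gt (f m) 0 with h | h
  · exact h.trans (div_nonneg hc hpos.le)
  · have h1 : ∑ s', L m s' * (if P s' then f s' else 0) ≤ ∑ s', L m s' * f m := by
      refine sum_le_sum fun s' _ => mul_le_mul_of_nonneg_left ?_ (hL0 m s' hPm)
      split_ifs with h'
      · exact hmax s' (by simpa using h')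
      · exact h.le
    rw [← sum_mul] at h1
    have h2 := mul_le_mul_of_nonneg_right (hL1 m hPm) h.le
    rw [le_div_iff₀ hpos]
    linarith [hf m hPm]

section Option

variable {S : Type} [Fintype S] [DecidableEq S] {P : S → Prop} [DecidablePred P]
  {L : S → S → ℝ} {γ : ℝ} {N : S → S → ℝ}

/-- The discounted exit distribution of a block is nonnegative. -/
theorem exitModel_nonneg (hγ1 : γ < 1) (hL0 : ∀ s s', 0 ≤ L s s') (hL1 : ∀ s, ∑ s', L s s' ≤ γ)
    (hN : ∀ s s', N s s' =
      ∑ s'', L s s'' * (if P s'' then N s'' s' else (if s'' = s' then 1 else 0)))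
    {s : S} (hs : P s) (s' : S) : 0 ≤ N s s' := by
  have key := le_div_of_le_add_sum_kernel P L γ 0 hγ1 le_rfl (fun s s' _ => hL0 s s')
    (fun s _ => hL1 s) (fun s => - N s s') ?_ s hs
  · simp only [zero_div] at key
    linarith
  · intro s _
    rw [hN s s', zero_add, ← sum_neg_distrib]
    refine sum_le_sum fun t _ => ?_
    rw [← mul_neg]
    refine mul_le_mul_of_nonneg_left ?_ (hL0 s t)
    split_ifs <;> simp

/-- The discounted exit distribution of a block has mass at most `γ`. -/
theorem sum_exitModel_le (hγ1 : γ < 1) (hL0 : ∀ s s', 0 ≤ L s s') (hL1 : ∀ s, ∑ s', L s s' ≤ γ)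
    (hN : ∀ s s', N s s' =
      ∑ s'', L s s'' * (if P s'' then N s'' s' else (if s'' = s' then 1 else 0)))
    (s : S) : ∑ s', N s s' ≤ γ := by
  have hsum : ∀ s, ∑ s', N s s' = ∑ t, L s t * (if P t then ∑ s', N t s' else 1) := by
    intro s
    simp_rw [hN s]
    rw [sum_comm]
    refine sum_congr rfl fun t _ => ?_
    rw [← mul_sum]
    split_ifs <;> simp
  have key : ∀ s, P s → ∑ s', N s s' - 1 ≤ 0 / (1 - γ) := by
    refine le_div_of_le_add_sum_kernel P L γ 0 hγ1 le_rfl (fun s s' _ => hL0 s s')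
      (fun s _ => hL1 s) (fun s => ∑ s', N s s' - 1) ?_
    intro s _
    have h : ∑ t, L s t * (if P t then ∑ s', N t s' else 1)
        = ∑ t, L s t * (if P t then ∑ s', N t s' - 1 else 0) + ∑ t, L s t := by
      rw [← sum_add_distrib]
      refine sum_congr rfl fun t _ => ?_
      split_ifs <;> ring
    rw [hsum s, h]
    linarith [hL1 s]
  rw [hsum s]
  refine le_trans (sum_le_sum fun t _ => ?_) (hL1 s)
  refine mul_le_of_le_one_right (hL0 s t) ?_
  split_ifs with ht
  · have := key t ht
    rw [zero_div] at this
    linarith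
  · exact le_rfl

/-- A value function decomposes through the multi-time model of a block. -/
theorem value_eq_reward_add_sum_exitModel
    (hγ1 : γ < 1) (hL0 : ∀ s s', 0 ≤ L s s') (hL1 : ∀ s, ∑ s', L s s' ≤ γ)
    (hN : ∀ s s', N s s' =
      ∑ s'', L s s'' * (if P s'' then N s'' s' else (if s'' = s' then 1 else 0)))
    {r ρ V : S → ℝ}
    (hρ : ∀ s, ρ s = r s + ∑ s', L s s' * (if P s' then ρ s' else 0))
    (hV : ∀ s, P s → V s = r s + ∑ s', L s s' * V s')
    {s : S} (hs : P s) : V s = ρ s + ∑ s', N s s' * V s' := by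
  have hNV : ∀ s, ∑ s', N s s' * V s'
      = ∑ t, L s t * (if P t then ∑ s', N t s' * V s' else V t) := by
    intro s
    simp_rw [hN s, sum_mul]
    rw [sum_comm]
    refine sum_congr rfl fun t _ => ?_
    simp_rw [mul_assoc]
    rw [← mul_sum]
    split_ifs <;> simp
  have hu : ∀ s, P s → V s - ρ s - ∑ s', N s s' * V s'
      = ∑ t, L s t * (if P t then V t - ρ t - ∑ s', N t s' * V s' else 0) := by
    intro s hs
    rw [hV s hs, hρ s, hNV s, add_sub_add_left_eq_sub, ← sum_sub_distrib, ← sum_sub_distrib]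
    refine sum_congr rfl fun t _ => ?_
    split_ifs <;> ring
  have h1 := le_div_of_le_add_sum_kernel P L γ 0 hγ1 le_rfl (fun s s' _ => hL0 s s')
    (fun s _ => hL1 s) (fun s => V s - ρ s - ∑ s', N s s' * V s')
    (fun s hs => by rw [zero_add]; exact (hu s hs).le) s hs
  have h2 := le_div_of_le_add_sum_kernel P L γ 0 hγ1 le_rfl (fun s s' _ => hL0 s s')
    (fun s _ => hL1 s) (fun s => -(V s - ρ s - ∑ s', N s s' * V s'))
    (fun s hs => by
      rw [zero_add, hu s hs, ← sum_neg_distrib]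
      refine (sum_congr rfl fun t _ => ?_).le
      split_ifs <;> ring) s hs
  simp only [zero_div] at h1 h2
  linarith

end Option

/-- (Value loss of the `O_{φ,M_ε}` class of `φ`-relative options.)
If every abstract state has an option whose multi-time model is `(ε_T, ε_R)`-close to that of
the optimal option, then the value loss of `(φ, O_φ)` is at most
`(ε_R + |S|·ε_T·RMax)/(1-γ)²`. -/
theorem stmt_12
    {S A Sφ : Type} [Fintype S] [Fintype A] [Fintype Sφ]
    [Nonempty S] [Nonempty A] [Nonempty Sφ] [DecidableEq S] [DecidableEq Sφ]
    -- the ground MDP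
    (R : S → A → ℝ) (T : S → A → S → ℝ) (γ RMax : ℝ)
    (hRMax : 0 < RMax)
    (hR : ∀ s a, 0 ≤ R s a ∧ R s a ≤ RMax)
    (hT0 : ∀ s a s', 0 ≤ T s a s')
    (hT1 : ∀ s a, ∑ s', T s a s' = 1)
    (hγ0 : 0 ≤ γ) (hγ1 : γ < 1)
    -- optimal value functions of the ground MDP (the unique Bellman fixed point)
    (Qstar : S → A → ℝ) (Vstar : S → ℝ)
    (hVstar : ∀ s, Vstar s = univ.sup' univ_nonempty (fun a => Qstar s a))
    (hQstar : ∀ s a, Qstar s a = R s a + γ * ∑ s', T s a s' * Vstar s')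
    -- the state abstraction
    (φ : S → Sφ) (hφ : Function.Surjective φ)
    -- an admissible set of φ-relative options: for each abstract state `x`, a nonempty set
    -- of ground policies (the policies of the options initiating exactly in the block of `x`)
    (Opts : Sφ → Set (S → A)) (hadm : ∀ x, (Opts x).Nonempty)
    -- `Qx x o s`: expected return of running option `o` from `s` until it exits the block of
    -- `x`, and acting optimally thereafter (the unique fixed point of the equation below)
    (Qx : Sφ → (S → A) → S → ℝ)
    (hQx : ∀ x (o : S → A) (s : S), Qx x o s = R s (o s) + γ * ∑ s', T s (o s) s' *
        (if φ s' = x then Qx x o s' else Vstar s'))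
    -- an optimal policy of the ground MDP; the optimal option `o*_x` follows it in the block
    (πstar : S → A) (hπstar : ∀ s, Qstar s (πstar s) = Vstar s)
    -- the ground value function of any deterministic ground policy
    (Vpol : (S → A) → S → ℝ)
    (hVpol : ∀ (p : S → A) (s : S), Vpol p s = R s (p s) + γ * ∑ s', T s (p s) s' * Vpol p s')
    -- the multi-time reward model of a φ-relative option (unique fixed point)
    (Ro : Sφ → (S → A) → S → ℝ)
    (hRo : ∀ x (o : S → A) (s : S), Ro x o s = R s (o s) + γ * ∑ s', T s (o s) s' *
        (if φ s' = x then Ro x o s' else 0))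
    -- the multi-time transition model of a φ-relative option (unique fixed point)
    (To : Sφ → (S → A) → S → S → ℝ)
    (hTo : ∀ x (o : S → A) (s s' : S), To x o s s' = γ * ∑ s'', T s (o s) s'' *
        (if φ s'' = x then To x o s'' s' else (if s'' = s' then 1 else 0)))
    -- every abstract state has an option whose multi-time model is close to the optimal one's
    (εT εR : ℝ) (hεT : 0 ≤ εT) (hεR : 0 ≤ εR)
    (hopt : ∀ x : Sφ, ∃ o ∈ Opts x, ∀ s, φ s = x →
      (∀ s', |To x πstar s s' - To x o s s'| ≤ εT) ∧ |Ro x πstar s - Ro x o s| ≤ εR) :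
    -- the value loss L(φ, O_φ) is at most (ε_R + |S|·ε_T·RMax)/(1-γ)²:
    ∃ μ : Sφ → (S → A), (∀ x, μ x ∈ Opts x) ∧
      ∀ s, Vstar s - Vpol (fun s' => μ (φ s') s') s ≤
        (εR + (Fintype.card S : ℝ) * εT * RMax) / (1 - γ) ^ 2 := by
  choose μ hμ hclose using hopt
  refine ⟨μ, hμ, ?_⟩
  have hpos : 0 < 1 - γ := by linarith
  have hL0 : ∀ (p : S → A) (s s' : S), 0 ≤ γ * T s (p s) s' :=
    fun p s s' => mul_nonneg hγ0 (hT0 _ _ _)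
  have hL1 : ∀ (p : S → A) (s : S), ∑ s', γ * T s (p s) s' ≤ γ := fun p s => by
    rw [← mul_sum, hT1, mul_one]
  have hN : ∀ x (o : S → A) (s s' : S), To x o s s' = ∑ s'', γ * T s (o s) s'' *
      (if φ s'' = x then To x o s'' s' else (if s'' = s' then 1 else 0)) := fun x o s s' => by
    rw [hTo x o s s', mul_sum]
    simp_rw [mul_assoc]
  have hρ : ∀ x (o : S → A) (s : S), Ro x o s = R s (o s) + ∑ s', γ * T s (o s) s' *
      (if φ s' = x then Ro x o s' else 0) := fun x o s => by
    rw [hRo x o s, mul_sum]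
    simp_rw [mul_assoc]
  have hVs : ∀ s, Vstar s = R s (πstar s) + ∑ s', γ * T s (πstar s) s' * Vstar s' := fun s => by
    rw [← hπstar s, hQstar, mul_sum]
    simp_rw [mul_assoc]
  set p : S → A := fun s' => μ (φ s') s' with hp
  have hVp : ∀ s, Vpol p s = R s (p s) + ∑ s', γ * T s (p s) s' * Vpol p s' := fun s => by
    rw [hVpol p s, mul_sum]
    simp_rw [mul_assoc]
  have hVs0 : ∀ s, 0 ≤ Vstar s := fun s => by
    have h := le_div_of_le_add_sum_kernel (fun _ => True) (fun s s' => γ * T s (πstar s) s') γ 0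
      hγ1 le_rfl (fun s s' _ => hL0 πstar s s') (fun s _ => hL1 πstar s) (fun s => - Vstar s)
      (fun s _ => by
        simp only [if_true, mul_neg, sum_neg_distrib]
        linarith [hVs s, (hR s (πstar s)).1]) s trivial
    simp only [zero_div] at h
    linarith
  have hVs1 : ∀ s, Vstar s ≤ RMax / (1 - γ) := fun s =>
    le_div_of_le_add_sum_kernel (fun _ => True) (fun s s' => γ * T s (πstar s) s') γ RMax
      hγ1 hRMax.le (fun s s' _ => hL0 πstar s s') (fun s _ => hL1 πstar s) Vstar
      (fun s _ => by
        simp only [if_true]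
        linarith [hVs s, (hR s (πstar s)).2]) s trivial
  have hdecS : ∀ s, Vstar s = Ro (φ s) πstar s + ∑ s', To (φ s) πstar s s' * Vstar s' := fun s =>
    value_eq_reward_add_sum_exitModel (P := fun t => φ t = φ s) hγ1 (hL0 πstar) (hL1 πstar)
      (hN (φ s) πstar) (hρ (φ s) πstar) (fun t _ => hVs t) rfl
  have hdecP : ∀ s, Vpol p s = Ro (φ s) (μ (φ s)) s + ∑ s', To (φ s) (μ (φ s)) s s' * Vpol p s' :=
    fun s => value_eq_reward_add_sum_exitModel (P := fun t => φ t = φ s) hγ1 (hL0 (μ (φ s)))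
      (hL1 (μ (φ s))) (hN (φ s) (μ (φ s))) (hρ (φ s) (μ (φ s)))
      (fun t ht => by
        have h := hVp t
        simp only [hp, ht] at h ⊢
        exact h) rfl
  have hC : 0 ≤ εR + (Fintype.card S : ℝ) * (εT * (RMax / (1 - γ))) := by positivity
  have hloss : ∀ s, Vstar s - Vpol p s ≤
      (εR + (Fintype.card S : ℝ) * (εT * (RMax / (1 - γ)))) / (1 - γ) := fun s =>
    le_div_of_le_add_sum_kernel (fun _ => True) (fun s s' => To (φ s) (μ (φ s)) s s') γ _
      hγ1 hC
      (fun s s' _ => exitModel_nonneg (P := fun t => φ t = φ s) hγ1 (hL0 (μ (φ s)))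
        (hL1 (μ (φ s))) (hN (φ s) (μ (φ s))) rfl s')
      (fun s _ => sum_exitModel_le (P := fun t => φ t = φ s) hγ1 (hL0 (μ (φ s)))
        (hL1 (μ (φ s))) (hN (φ s) (μ (φ s))) s)
      (fun s => Vstar s - Vpol p s)
      (fun s _ => by
        simp only [if_true]
        obtain ⟨hcT, hcR⟩ := hclose (φ s) s rfl
        have hT' : ∑ s', (To (φ s) πstar s s' - To (φ s) (μ (φ s)) s s') * Vstar s'
            ≤ (Fintype.card S : ℝ) * (εT * (RMax / (1 - γ))) := by
          rw [← nsmul_eq_mul]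
          refine sum_le_card_nsmul _ _ _ fun s' _ => ?_
          exact mul_le_mul ((le_abs_self _).trans (hcT s')) (hVs1 s') (hVs0 s') hεT
        simp only [sub_mul, mul_sub, sum_sub_distrib] at hT' ⊢
        linarith [hdecS s, hdecP s, (le_abs_self _).trans hcR]) s trivial
  intro s
  refine (hloss s).trans ?_
  rw [div_le_div_iff₀ hpos (by positivity)]
  have h1 : RMax / (1 - γ) * (1 - γ) = RMax := div_mul_cancel₀ _ hpos.ne'
  have h2 : (εR + (Fintype.card S : ℝ) * (εT * (RMax / (1 - γ)))) * (1 - γ) ^ 2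
      = (εR * (1 - γ) + (Fintype.card S : ℝ) * εT * RMax) * (1 - γ) := by
    linear_combination (Fintype.card S : ℝ) * εT * (1 - γ) * h1
  rw [h2]
  refine mul_le_mul_of_nonneg_right ?_ hpos.le
  linarith [mul_nonneg hεR hγ0]
end

section
/- Let M = (S, A, R, T, γ) be a finite goal-based MDP, φ : S → S_φ a state abstraction in which every goal state forms its own singleton abstract state, and O_φ an admissible set of φ-relative options. Suppose there is τ ≥ 0 such that for every abstract state x ∈ S_φ there exists an option o ∈ O_φ for x with |p(s',k|s, o*_x) − p(s',k|s, o)| ≤ τ for all k ≥ 1, all s ∈ φ⁻¹(x), and all s' ∈ S, where p(s',k|s,o) is the probability that option o, started at s, terminates in state s' after exactly k steps. Then the value loss satisfies L(φ, O_φ) ≤ τ·γ·|S|/(1−γ)². -/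
open Finset

section BlockExit

variable {S : Type*} [Fintype S]

/-- A distribution with an atom of mass one averages every function to its value at the atom. -/
lemma sum_mul_eq_of_eq_one {t : S → ℝ} (ht0 : ∀ s, 0 ≤ t s) (ht1 : ∑ s, t s = 1)
    {a : S} (ha : t a = 1) (f : S → ℝ) : ∑ s, t s * f s = f a := by
  classical
  have hsplit := Finset.add_sum_erase univ t (mem_univ a)
  have hzero : ∀ s ∈ univ.erase a, t s = 0 :=
    (Finset.sum_eq_zero_iff_of_nonneg fun s _ => ht0 s).1 (by linarith)
  rw [← Finset.add_sum_erase univ _ (mem_univ a), ha, one_mul,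
    Finset.sum_eq_zero fun s hs => by rw [hzero s hs, zero_mul], add_zero]

lemma sum_mul_le_of_le {t : S → ℝ} (ht0 : ∀ s, 0 ≤ t s) (ht1 : ∑ s, t s = 1)
    {f : S → ℝ} {c : ℝ} (hf : ∀ s, f s ≤ c) : ∑ s, t s * f s ≤ c :=
  calc ∑ s, t s * f s ≤ ∑ s, t s * c :=
        Finset.sum_le_sum fun s _ => mul_le_mul_of_nonneg_left (hf s) (ht0 s)
    _ = c := by rw [← Finset.sum_mul, ht1, one_mul]

lemma le_sum_mul_of_le {t : S → ℝ} (ht0 : ∀ s, 0 ≤ t s) (ht1 : ∑ s, t s = 1)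
    {f : S → ℝ} {c : ℝ} (hf : ∀ s, c ≤ f s) : c ≤ ∑ s, t s * f s :=
  calc c = ∑ s, t s * c := by rw [← Finset.sum_mul, ht1, one_mul]
    _ ≤ ∑ s, t s * f s :=
        Finset.sum_le_sum fun s _ => mul_le_mul_of_nonneg_left (hf s) (ht0 s)

/-- `p k s s'` is the probability that the Markov chain with kernel `t`, started at `s`, takes
`k + 1` steps to leave `B` and arrives in `s'`. -/
structure IsBlockExit (t : S → S → ℝ) (B : S → Prop) [DecidablePred B]
    (p : ℕ → S → S → ℝ) : Prop where
  nonneg : ∀ s s', 0 ≤ t s s'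
  sum_eq_one : ∀ s, ∑ s', t s s' = 1
  zero : ∀ s s', p 0 s s' = if B s' then 0 else t s s'
  succ : ∀ k s s', p (k + 1) s s' = ∑ s'' ∈ univ.filter B, t s s'' * p k s'' s'

namespace IsBlockExit

variable {t : S → S → ℝ} {B : S → Prop} [DecidablePred B] {p : ℕ → S → S → ℝ}

lemma exit_nonneg (h : IsBlockExit t B p) (k : ℕ) (s s' : S) : 0 ≤ p k s s' := by
  induction k generalizing s with
  | zero => rw [h.zero]; split_ifs; exacts [le_rfl, h.nonneg s s']
  | succ k ih =>
    rw [h.succ]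
    exact Finset.sum_nonneg fun _ _ => mul_nonneg (h.nonneg _ _) (ih _)

/-- One-step recursion for the discounted value collected on exit within `n + 1` steps. -/
lemma sum_range_succ (h : IsBlockExit t B p) (γ : ℝ) (V : S → ℝ) (n : ℕ) (s : S) :
    ∑ k ∈ range (n + 1), γ ^ (k + 1) * ∑ s', p k s s' * V s' =
      γ * ∑ s', t s s' *
        if B s' then ∑ k ∈ range n, γ ^ (k + 1) * ∑ s'', p k s' s'' * V s'' else V s' := by
  have hsucc : ∀ k, ∑ s', p (k + 1) s s' * V s' =
      ∑ s', if B s' then t s s' * ∑ s'', p k s' s'' * V s'' else 0 := fun k => by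
    rw [← Finset.sum_filter]
    simp_rw [h.succ, Finset.sum_mul, Finset.mul_sum]
    rw [Finset.sum_comm]
    simp_rw [mul_assoc]
  have hzero : ∑ s', p 0 s s' * V s' = ∑ s', if B s' then 0 else t s s' * V s' := by
    refine Finset.sum_congr rfl fun s' _ => ?_
    rw [h.zero]; split_ifs <;> simp
  rw [Finset.sum_range_succ', hzero]
  simp_rw [hsucc, Finset.mul_sum]
  rw [Finset.sum_comm, ← Finset.sum_add_distrib]
  refine Finset.sum_congr rfl fun s' _ => ?_
  split_ifs
  · simp only [mul_zero, add_zero, Finset.mul_sum]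
    refine Finset.sum_congr rfl fun k _ => Finset.sum_congr rfl fun s'' _ => ?_
    ring
  · simp

/-- The exit probabilities have total mass at most one, so their discounted mass is at most
`γ`. -/
lemma discounted_mass_le (h : IsBlockExit t B p) {γ : ℝ} (hγ0 : 0 ≤ γ) (hγ1 : γ ≤ 1)
    (n : ℕ) (s : S) : ∑ k ∈ range n, γ ^ (k + 1) * ∑ s', p k s s' ≤ γ := by
  induction n generalizing s with
  | zero => simpa using hγ0
  | succ n ih =>
    have hrec := h.sum_range_succ γ (fun _ => 1) n s
    simp only [mul_one] at hrec
    rw [hrec]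
    refine mul_le_of_le_one_right hγ0 (sum_mul_le_of_le (h.nonneg s) (h.sum_eq_one s) fun s' => ?_)
    split_ifs
    exacts [(ih s').trans hγ1, le_rfl]

/-- Truncated expansion of a value function without rewards inside the block. -/
lemma abs_sub_sum_range_le (h : IsBlockExit t B p) {γ : ℝ} (hγ0 : 0 ≤ γ) {V : S → ℝ}
    (hV : ∀ s, B s → V s = γ * ∑ s', t s s' * V s') {C : ℝ} (hC : ∀ s, |V s| ≤ C)
    (n : ℕ) {s : S} (hs : B s) :
    |V s - ∑ k ∈ range n, γ ^ (k + 1) * ∑ s', p k s s' * V s'| ≤ γ ^ n * C := by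
  induction n generalizing s with
  | zero => simpa using hC s
  | succ n ih =>
    have hC0 : 0 ≤ C := (abs_nonneg _).trans (hC s)
    rw [h.sum_range_succ γ V n s, hV s hs, ← mul_sub, ← Finset.sum_sub_distrib, abs_mul,
      abs_of_nonneg hγ0, pow_succ', mul_assoc]
    refine mul_le_mul_of_nonneg_left ((Finset.abs_sum_le_sum_abs _ _).trans ?_) hγ0
    simp_rw [← mul_sub, abs_mul, abs_of_nonneg (h.nonneg s _)]
    refine sum_mul_le_of_le (h.nonneg s) (h.sum_eq_one s) fun s' => ?_
    split_ifs with hs'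
    · exact ih hs'
    · simpa using mul_nonneg (pow_nonneg hγ0 n) hC0

/-- Comparison of two reward-free value functions on a block whose exit probabilities are
uniformly close. -/
lemma sub_le_of_close {t' : S → S → ℝ} {q : ℕ → S → S → ℝ}
    (h : IsBlockExit t B p) (h' : IsBlockExit t' B q) {γ : ℝ} (hγ0 : 0 ≤ γ) (hγ1 : γ < 1)
    {V W : S → ℝ} (hV : ∀ s, B s → V s = γ * ∑ s', t s s' * V s')
    (hW : ∀ s, B s → W s = γ * ∑ s', t' s s' * W s')
    (hV0 : ∀ s, 0 ≤ V s) (hV1 : ∀ s, V s ≤ 1)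
    {τ D : ℝ} (hD0 : 0 ≤ D) (hD : ∀ s, V s - W s ≤ D) {s : S} (hs : B s) (hτ : 0 ≤ τ)
    (hpq : ∀ k s', |p k s s' - q k s s'| ≤ τ) :
    V s - W s ≤ τ * γ * (Fintype.card S : ℝ) / (1 - γ) + γ * D := by
  obtain ⟨C, hC⟩ : ∃ C, ∀ s, |W s| ≤ C :=
    ⟨∑ s, |W s|, fun s => Finset.single_le_sum (f := fun s => |W s|)
      (fun s _ => abs_nonneg _) (mem_univ s)⟩
  have h1γ : 0 < 1 - γ := sub_pos.2 hγ1
  have hstep : ∀ n, V s - W s ≤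
      τ * γ * (Fintype.card S : ℝ) / (1 - γ) + γ * D + γ ^ n * (1 + C) := fun n => by
    have hVn := (abs_le.1 (h.abs_sub_sum_range_le hγ0 hV
      (fun s => (abs_of_nonneg (hV0 s)).trans_le (hV1 s)) n hs)).2
    have hWn := (abs_le.1 (h'.abs_sub_sum_range_le hγ0 hW hC n hs)).1
    have hterm : ∀ k s', p k s s' * V s' - q k s s' * W s' ≤ τ + q k s s' * D := fun k s' => by
      have h₁ : (p k s s' - q k s s') * V s' ≤ τ :=
        (mul_le_mul_of_nonneg_right ((le_abs_self _).trans (hpq k s')) (hV0 s')).trans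
          (mul_le_of_le_one_right hτ (hV1 s'))
      have h₂ := mul_le_mul_of_nonneg_left (hD s') (h'.exit_nonneg k s s')
      linarith
    have hsum : ∑ k ∈ range n, γ ^ (k + 1) * ∑ s', p k s s' * V s' -
        ∑ k ∈ range n, γ ^ (k + 1) * ∑ s', q k s s' * W s' ≤
        (∑ k ∈ range n, γ ^ k) * (γ * (Fintype.card S * τ)) +
          (∑ k ∈ range n, γ ^ (k + 1) * ∑ s', q k s s') * D := by
      rw [← Finset.sum_sub_distrib, Finset.sum_mul, Finset.sum_mul, ← Finset.sum_add_distrib]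
      refine Finset.sum_le_sum fun k _ => ?_
      have hk : ∑ s', (p k s s' * V s' - q k s s' * W s') ≤ ∑ s', (τ + q k s s' * D) :=
        Finset.sum_le_sum fun s' _ => hterm k s'
      rw [Finset.sum_sub_distrib, Finset.sum_add_distrib, ← Finset.sum_mul, Finset.sum_const,
        Finset.card_univ, nsmul_eq_mul] at hk
      have := mul_le_mul_of_nonneg_left hk (pow_nonneg hγ0 (k + 1))
      calc _ = γ ^ (k + 1) * (∑ s', p k s s' * V s' - ∑ s', q k s s' * W s') := by ring
        _ ≤ _ := this
        _ = _ := by ring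
    have hgeom : ∑ k ∈ range n, γ ^ k ≤ 1 / (1 - γ) := by
      rw [le_div_iff₀ h1γ, mul_comm, mul_neg_geom_sum]
      linarith [pow_nonneg hγ0 n]
    have hgeom' := mul_le_mul_of_nonneg_right hgeom
      (mul_nonneg hγ0 (mul_nonneg (Nat.cast_nonneg (Fintype.card S)) hτ))
    have hmass := mul_le_mul_of_nonneg_right (h'.discounted_mass_le hγ0 hγ1.le n s) hD0
    have heq : 1 / (1 - γ) * (γ * (Fintype.card S * τ)) =
        τ * γ * (Fintype.card S : ℝ) / (1 - γ) := by ring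
    linarith
  refine ge_of_tendsto' (x := Filter.atTop) ?_ hstep
  simpa using ((tendsto_pow_atTop_nhds_zero_of_lt_one hγ0 hγ1).mul_const (1 + C)).const_add
    (τ * γ * (Fintype.card S : ℝ) / (1 - γ) + γ * D)

end IsBlockExit

end BlockExit

/-- (Value loss of the `O_{φ,τ}` class of `φ`-relative options in goal-based
MDPs.)  If every abstract state has an option whose `k`-step termination-state distributions
are `τ`-close to those of the optimal option, then the value loss of `(φ, O_φ)` is at most
`τ·γ·|S|/(1-γ)²`. -/
theorem stmt_13
    {S A Sφ : Type} [Fintype S] [Fintype A] [Fintype Sφ]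
    [Nonempty S] [Nonempty A] [Nonempty Sφ] [DecidableEq S] [DecidableEq Sφ]
    -- the ground MDP
    (R : S → A → ℝ) (T : S → A → S → ℝ) (γ : ℝ)
    (hT0 : ∀ s a s', 0 ≤ T s a s')
    (hT1 : ∀ s a, ∑ s', T s a s' = 1)
    (hγ0 : 0 ≤ γ) (hγ1 : γ < 1)
    -- the MDP is goal-based: reward 1 exactly at goal states, and every goal state moves
    -- with probability 1 to a zero-reward absorbing sink
    (SG : Finset S)
    (hRgoal : ∀ s a, R s a = if s ∈ SG then 1 else 0)
    (sink : S) (hsinkNG : sink ∉ SG)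
    (hTgoal : ∀ g ∈ SG, ∀ a, T g a sink = 1)
    (hTsink : ∀ a, T sink a sink = 1)
    -- optimal value functions of the ground MDP (the unique Bellman fixed point)
    (Qstar : S → A → ℝ) (Vstar : S → ℝ)
    (hVstar : ∀ s, Vstar s = univ.sup' univ_nonempty (fun a => Qstar s a))
    (hQstar : ∀ s a, Qstar s a = R s a + γ * ∑ s', T s a s' * Vstar s')
    -- the state abstraction; every goal state forms its own singleton abstract state
    (φ : S → Sφ) (hφ : Function.Surjective φ)
    (hsingleton : ∀ g ∈ SG, ∀ s, φ s = φ g → s = g)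
    -- an admissible set of φ-relative options
    (Opts : Sφ → Set (S → A)) (hadm : ∀ x, (Opts x).Nonempty)
    -- `Qx x o s`: expected return of running option `o` from `s` until it exits the block of
    -- `x`, and acting optimally thereafter (the unique fixed point of the equation below)
    (Qx : Sφ → (S → A) → S → ℝ)
    (hQx : ∀ x (o : S → A) (s : S), Qx x o s = R s (o s) + γ * ∑ s', T s (o s) s' *
        (if φ s' = x then Qx x o s' else Vstar s'))
    -- an optimal policy of the ground MDP; the optimal option `o*_x` follows it in the block
    (πstar : S → A) (hπstar : ∀ s, Qstar s (πstar s) = Vstar s)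
    -- the ground value function of any deterministic ground policy
    (Vpol : (S → A) → S → ℝ)
    (hVpol : ∀ (p : S → A) (s : S), Vpol p s = R s (p s) + γ * ∑ s', T s (p s) s' * Vpol p s')
    -- `Pk x o k s s'`: probability that option `o`, started at `s` in the block of `x`,
    -- terminates in `s'` after exactly `k` steps
    (Pk : Sφ → (S → A) → ℕ → S → S → ℝ)
    (hPk1 : ∀ x (o : S → A) (s s' : S),
      Pk x o 1 s s' = if φ s' = x then 0 else T s (o s) s')
    (hPk2 : ∀ x (o : S → A) (k : ℕ) (s s' : S),
      Pk x o (k + 2) s s' =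
        ∑ s'' ∈ univ.filter (fun s'' => φ s'' = x), T s (o s) s'' * Pk x o (k + 1) s'' s')
    -- every abstract state has an option whose k-step termination-state distributions are
    -- τ-close to those of the optimal option
    (τ : ℝ) (hτ : 0 ≤ τ)
    (hopt : ∀ x : Sφ, ∃ o ∈ Opts x, ∀ k : ℕ, 1 ≤ k → ∀ s, φ s = x → ∀ s',
      |Pk x πstar k s s' - Pk x o k s s'| ≤ τ) :
    -- the value loss L(φ, O_φ) is at most τ·γ·|S|/(1-γ)²:
    ∃ μ : Sφ → (S → A), (∀ x, μ x ∈ Opts x) ∧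
      ∀ s, Vstar s - Vpol (fun s' => μ (φ s') s') s ≤
        τ * γ * (Fintype.card S : ℝ) / (1 - γ) ^ 2 := by
  choose μ hμ hclose using hopt
  refine ⟨μ, hμ, ?_⟩
  have hVs : ∀ s, Vstar s = R s (πstar s) + γ * ∑ s', T s (πstar s) s' * Vstar s' :=
    fun s => (hπstar s).symm.trans (hQstar s _)
  set W := Vpol (fun s' => μ (φ s') s') with hW
  have hWs : ∀ s, W s = R s (μ (φ s) s) + γ * ∑ s', T s (μ (φ s) s) s' * W s' :=
    fun s => hVpol _ s
  have h1γ : 0 < 1 - γ := sub_pos.2 hγ1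
  have hsink : ∀ (V : S → ℝ) (a : A), V sink = R sink a + γ * ∑ s', T sink a s' * V s' →
      V sink = 0 := fun V a hV => by
    rw [sum_mul_eq_of_eq_one (hT0 _ _) (hT1 _ _) (hTsink a), hRgoal, if_neg hsinkNG] at hV
    have : (1 - γ) * V sink = 0 := by linarith
    exact (mul_eq_zero.1 this).resolve_left h1γ.ne'
  have hgoal : ∀ (V : S → ℝ), V sink = 0 → ∀ g ∈ SG, ∀ a : A,
      V g = R g a + γ * ∑ s', T g a s' * V s' → V g = 1 := fun V h0 g hg a hV => by
    rw [sum_mul_eq_of_eq_one (hT0 _ _) (hT1 _ _) (hTgoal g hg a), hRgoal, if_pos hg, h0] at hV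
    simpa using hV
  have hVsink := hsink Vstar _ (hVs sink)
  have hWsink := hsink W _ (hWs sink)
  have hV0 : ∀ s, 0 ≤ Vstar s := by
    obtain ⟨m, hm⟩ := Finite.exists_min Vstar
    have hR : 0 ≤ R m (πstar m) := by rw [hRgoal]; split_ifs <;> norm_num
    have hmγ := mul_le_mul_of_nonneg_left
      (le_sum_mul_of_le (hT0 m (πstar m)) (hT1 m (πstar m)) hm) hγ0
    have hm0 : 0 ≤ (1 - γ) * Vstar m := by linarith [hVs m]
    exact fun s => (nonneg_of_mul_nonneg_right hm0 h1γ).trans (hm s)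
  have hV1 : ∀ s, Vstar s ≤ 1 := by
    obtain ⟨m, hm⟩ := Finite.exists_max Vstar
    refine fun s => (hm s).trans ?_
    by_cases hmg : m ∈ SG
    · exact (hgoal Vstar hVsink m hmg _ (hVs m)).le
    · have hR : R m (πstar m) = 0 := by rw [hRgoal, if_neg hmg]
      have hmγ := mul_le_mul_of_nonneg_left
        (sum_mul_le_of_le (hT0 m (πstar m)) (hT1 m (πstar m)) hm) hγ0
      have hm0 : (1 - γ) * Vstar m ≤ (1 - γ) * 0 := by linarith [hVs m]
      exact (le_of_mul_le_mul_left hm0 h1γ).trans zero_le_one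
  have hexit : ∀ x (o : S → A),
      IsBlockExit (fun s s' => T s (o s) s') (fun s => φ s = x) (fun k => Pk x o (k + 1)) :=
    fun x o => ⟨fun s => hT0 s (o s), fun s => hT1 s (o s), hPk1 x o, hPk2 x o⟩
  obtain ⟨m, hm⟩ := Finite.exists_max fun s => Vstar s - W s
  have hD0 : 0 ≤ Vstar m - W m := by simpa [hVsink, hWsink] using hm sink
  have hδ : 0 ≤ τ * γ * (Fintype.card S : ℝ) / (1 - γ) := by positivity
  have hloss : Vstar m - W m ≤
      τ * γ * (Fintype.card S : ℝ) / (1 - γ) + γ * (Vstar m - W m) := by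
    by_cases hmg : m ∈ SG
    · have hm0 : Vstar m - W m = 0 := by
        rw [hgoal Vstar hVsink m hmg _ (hVs m), hgoal W hWsink m hmg _ (hWs m), sub_self]
      rw [hm0]
      simpa using hδ
    · have hR : ∀ s, φ s = φ m → ∀ a, R s a = 0 := fun s hs a => by
        rw [hRgoal, if_neg]
        exact fun hsg => hmg (hsingleton s hsg m hs.symm ▸ hsg)
      refine (hexit (φ m) πstar).sub_le_of_close (hexit (φ m) (μ (φ m))) hγ0 hγ1
        (fun s hs => ?_) (fun s hs => ?_) hV0 hV1 hD0 hm rfl hτ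
        fun k s' => hclose (φ m) (k + 1) (Nat.le_add_left 1 k) m rfl s'
      · rw [hVs s, hR s hs, zero_add]
      · have := hWs s
        rwa [hs, hR s hs, zero_add] at this
  refine fun s => (hm s).trans ?_
  rw [pow_two, ← div_div, le_div_iff₀ h1γ]
  linarith
end

section
/- Let M = (S, A, R, T, γ) be a finite MDP, φ : S → S_φ a state abstraction, w a weighting function, and O_φ an admissible set of φ-relative options. For a deterministic assignment π of options to abstract states, define the one-step abstract models T_φ(y|x, π) = Σ_{s:φ(s)=x} w(s) Σ_{s':φ(s')=y} T(s'|s, π_{o_x}(s)) and R_φ(x, π) = Σ_{s:φ(s)=x} w(s)·R(s, π_{o_x}(s)), where o_x = π(x), and set K_p(π) = max_{s∈S, a∈A} Σ_{y∈S_φ} |Σ_{s':φ(s')=y} T(s'|s,a) − T_φ(y|φ(s), π)| and K_r(π) = max_{s∈S, a∈A} |R(s,a) − R_φ(φ(s), π)|. If there are ε_p, ε_r ≥ 0 such that every deterministic assignment π satisfies K_p(π) ≤ ε_p and K_r(π) ≤ ε_r, then the value loss satisfies L(φ, O_φ) ≤ (2/(1−γ))·(ε_r + (γ·RMax/(1−γ))·(ε_p/2)).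 -/
open Finset

/-- A subsolution of a discounted affine equation with a stochastic kernel is bounded by the
discounted sum of the constant term. -/
lemma le_div_of_le_add_discounted {X : Type*} [Fintype X] {P : X → X → ℝ}
    (hP0 : ∀ x y, 0 ≤ P x y) (hP1 : ∀ x, ∑ y, P x y = 1) {γ : ℝ} (hγ0 : 0 ≤ γ) (hγ1 : γ < 1)
    {f : X → ℝ} {c : ℝ} (hf : ∀ x, f x ≤ c + γ * ∑ y, P x y * f y) (x : X) :
    f x ≤ c / (1 - γ) := by
  have : Nonempty X := ⟨x⟩
  obtain ⟨m, hm⟩ := Finite.exists_max f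
  have hsum : ∑ y, P m y * f y ≤ f m :=
    calc ∑ y, P m y * f y ≤ ∑ y, P m y * f m :=
          sum_le_sum fun y _ => mul_le_mul_of_nonneg_left (hm y) (hP0 m y)
      _ = f m := by rw [← sum_mul, hP1, one_mul]
  refine (hm x).trans ?_
  rw [le_div_iff₀ (by linarith)]
  linarith [hf m, mul_le_mul_of_nonneg_left hsum hγ0]

/-- The policy evaluation equation of a finite discounted Markov reward process is solvable. -/
lemma exists_discounted_value {X : Type*} [Fintype X] {P : X → X → ℝ}
    (hP0 : ∀ x y, 0 ≤ P x y) (hP1 : ∀ x, ∑ y, P x y = 1) {γ : ℝ} (hγ0 : 0 ≤ γ) (hγ1 : γ < 1)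
    (r : X → ℝ) : ∃ v : X → ℝ, ∀ x, v x = r x + γ * ∑ y, P x y * v y := by
  let L : (X → ℝ) →ₗ[ℝ] (X → ℝ) := LinearMap.id - γ • Matrix.mulVecLin (Matrix.of P)
  have hL : ∀ v x, L v x = v x - γ * ∑ y, P x y * v y := fun v x => by
    simp [L, Matrix.mulVec, dotProduct]
  have hinj : Function.Injective L := by
    rw [← LinearMap.ker_eq_bot, LinearMap.ker_eq_bot']
    intro v hv
    have hfix : ∀ x, v x = γ * ∑ y, P x y * v y := fun x => by
      have := hL v x
      rw [hv, Pi.zero_apply] at this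
      linarith
    ext x
    have hle := le_div_of_le_add_discounted hP0 hP1 hγ0 hγ1 (f := v) (c := 0)
      (fun x => by linarith [hfix x]) x
    have hge := le_div_of_le_add_discounted hP0 hP1 hγ0 hγ1 (f := fun x => -v x) (c := 0)
      (fun x => by simp only [mul_neg, sum_neg_distrib]; linarith [hfix x]) x
    rw [zero_div] at hle hge
    exact le_antisymm hle (neg_nonpos.mp hge)
  obtain ⟨v, hv⟩ := LinearMap.injective_iff_surjective.mp hinj r
  refine ⟨v, fun x => ?_⟩
  have := hL v x
  rw [hv] at this
  linarith

/-- The pairing of a signed vector of total mass zero with values in `[0, M]` is at most `M / 2`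
times the `ℓ¹` norm of the vector. -/
lemma abs_sum_mul_le_of_sum_eq_zero {Y : Type*} [Fintype Y] {d v : Y → ℝ} {M : ℝ}
    (hd : ∑ y, d y = 0) (hv0 : ∀ y, 0 ≤ v y) (hvM : ∀ y, v y ≤ M) :
    |∑ y, d y * v y| ≤ (∑ y, |d y|) * (M / 2) := by
  have hcenter : ∑ y, d y * v y = ∑ y, d y * (v y - M / 2) := by
    simp_rw [mul_sub]
    rw [sum_sub_distrib, ← sum_mul, hd, zero_mul, sub_zero]
  rw [hcenter, sum_mul]
  refine (abs_sum_le_sum_abs _ _).trans (sum_le_sum fun y _ => ?_)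
  rw [abs_mul]
  refine mul_le_mul_of_nonneg_left ?_ (abs_nonneg _)
  rw [abs_le]
  constructor <;> linarith [hv0 y, hvM y]

/-- If an abstract Markov reward process approximates a ground one with respect to block
transitions and rewards, then their value functions are close. -/
lemma abs_value_sub_abstract_value_le {S Y : Type*} [Fintype S] [Fintype Y] [DecidableEq Y]
    {φ : S → Y} {P : S → S → ℝ} {Q : Y → Y → ℝ} {r : S → ℝ} {ρ : Y → ℝ} {γ M εp εr : ℝ}
    (hP0 : ∀ s s', 0 ≤ P s s') (hP1 : ∀ s, ∑ s', P s s' = 1) (hQ1 : ∀ x, ∑ y, Q x y = 1)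
    (hγ0 : 0 ≤ γ) (hγ1 : γ < 1) {V : S → ℝ} {v : Y → ℝ}
    (hV : ∀ s, V s = r s + γ * ∑ s', P s s' * V s')
    (hv : ∀ x, v x = ρ x + γ * ∑ y, Q x y * v y)
    (hv0 : ∀ y, 0 ≤ v y) (hvM : ∀ y, v y ≤ M) (hM : 0 ≤ M)
    (hr : ∀ s, |r s - ρ (φ s)| ≤ εr)
    (hp : ∀ s, ∑ y, |(∑ s' ∈ univ.filter (fun s' => φ s' = y), P s s') - Q (φ s) y| ≤ εp)
    (s : S) : |V s - v (φ s)| ≤ (εr + γ * (εp * (M / 2))) / (1 - γ) := by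
  have hblock : ∀ s (g : Y → ℝ),
      ∑ y, (∑ s' ∈ univ.filter (fun s' => φ s' = y), P s s') * g y =
        ∑ s', P s s' * g (φ s') := by
    intro s g
    rw [← sum_fiberwise univ φ]
    refine sum_congr rfl fun y _ => ?_
    rw [sum_mul]
    refine sum_congr rfl fun s' hs' => ?_
    rw [(mem_filter.mp hs').2]
  have hstep : ∀ s, |(V s - v (φ s)) - γ * ∑ s', P s s' * (V s' - v (φ s'))| ≤
      εr + γ * (εp * (M / 2)) := by
    intro s
    have hmass : ∑ y, ((∑ s' ∈ univ.filter (fun s' => φ s' = y), P s s') - Q (φ s) y) = 0 := by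
      have := hblock s 1
      simp only [Pi.one_apply, mul_one, hP1] at this
      rw [sum_sub_distrib, this, hQ1, sub_self]
    have hpair := (abs_sum_mul_le_of_sum_eq_zero hmass hv0 hvM).trans
      (mul_le_mul_of_nonneg_right (hp s) (by linarith))
    have heq : (V s - v (φ s)) - γ * ∑ s', P s s' * (V s' - v (φ s')) = (r s - ρ (φ s)) +
        γ * ∑ y, ((∑ s' ∈ univ.filter (fun s' => φ s' = y), P s s') - Q (φ s) y) * v y := by
      simp_rw [sub_mul, mul_sub]
      rw [sum_sub_distrib, sum_sub_distrib, hblock s v, hV s, hv (φ s)]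
      ring
    rw [heq]
    refine (abs_add_le _ _).trans (add_le_add (hr s) ?_)
    rw [abs_mul, abs_of_nonneg hγ0]
    exact mul_le_mul_of_nonneg_left hpair hγ0
  rw [abs_le']
  constructor
  · exact le_div_of_le_add_discounted hP0 hP1 hγ0 hγ1 (f := fun s => V s - v (φ s))
      (fun s => by linarith [(abs_le.mp (hstep s)).2]) s
  · refine le_div_of_le_add_discounted hP0 hP1 hγ0 hγ1 (f := fun s => -(V s - v (φ s)))
      (fun s => ?_) s
    simp_rw [mul_neg, sum_neg_distrib]
    linarith [(abs_le.mp (hstep s)).1]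

/-- (Value loss of the `O_{φ,H}` class of `φ`-relative options.)
If every deterministic assignment of options to abstract states induces an
`(ε_p, ε_r)`-approximate MDP homomorphism, then the value loss of `(φ, O_φ)` is at most
`(2/(1-γ))·(ε_r + (γ·RMax/(1-γ))·(ε_p/2))`. -/
theorem stmt_14
    {S A Sφ : Type} [Fintype S] [Fintype A] [Fintype Sφ]
    [Nonempty S] [Nonempty A] [Nonempty Sφ] [DecidableEq Sφ]
    -- the ground MDP
    (R : S → A → ℝ) (T : S → A → S → ℝ) (γ RMax : ℝ)
    (hRMax : 0 < RMax)
    (hR : ∀ s a, 0 ≤ R s a ∧ R s a ≤ RMax)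
    (hT0 : ∀ s a s', 0 ≤ T s a s')
    (hT1 : ∀ s a, ∑ s', T s a s' = 1)
    (hγ0 : 0 ≤ γ) (hγ1 : γ < 1)
    -- optimal value functions of the ground MDP (the unique Bellman fixed point)
    (Qstar : S → A → ℝ) (Vstar : S → ℝ)
    (hVstar : ∀ s, Vstar s = univ.sup' univ_nonempty (fun a => Qstar s a))
    (hQstar : ∀ s a, Qstar s a = R s a + γ * ∑ s', T s a s' * Vstar s')
    -- the state abstraction
    (φ : S → Sφ) (hφ : Function.Surjective φ)
    -- an admissible set of φ-relative options: for each abstract state `x`, a nonempty set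
    -- of ground policies (the policies of the options initiating exactly in the block of `x`)
    (Opts : Sφ → Set (S → A)) (hadm : ∀ x, (Opts x).Nonempty)
    -- `Qx x o s`: expected return of running option `o` from `s` until it exits the block of
    -- `x`, and acting optimally thereafter (the unique fixed point of the equation below)
    (Qx : Sφ → (S → A) → S → ℝ)
    (hQx : ∀ x (o : S → A) (s : S), Qx x o s = R s (o s) + γ * ∑ s', T s (o s) s' *
        (if φ s' = x then Qx x o s' else Vstar s'))
    -- an optimal policy of the ground MDP; the optimal option `o*_x` follows it in the block
    (πstar : S → A) (hπstar : ∀ s, Qstar s (πstar s) = Vstar s)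
    -- the ground value function of any deterministic ground policy
    (Vpol : (S → A) → S → ℝ)
    (hVpol : ∀ (p : S → A) (s : S), Vpol p s = R s (p s) + γ * ∑ s', T s (p s) s' * Vpol p s')
    -- a weighting function
    (w : S → ℝ) (hw : ∀ s, 0 ≤ w s ∧ w s ≤ 1)
    (hwsum : ∀ x : Sφ, ∑ s ∈ univ.filter (fun s => φ s = x), w s = 1)
    -- every deterministic assignment of options induces an (ε_p, ε_r)-approximate MDP
    -- homomorphism: K_p(μ) ≤ ε_p and K_r(μ) ≤ ε_r
    (εp εr : ℝ) (hεp : 0 ≤ εp) (hεr : 0 ≤ εr)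
    (hKp : ∀ μ : Sφ → (S → A), (∀ x, μ x ∈ Opts x) →
      ∀ s a, ∑ y : Sφ,
        |(∑ s' ∈ univ.filter (fun s' => φ s' = y), T s a s') -
          (∑ u ∈ univ.filter (fun u => φ u = φ s), w u *
            ∑ s' ∈ univ.filter (fun s' => φ s' = y), T u (μ (φ s) u) s')| ≤ εp)
    (hKr : ∀ μ : Sφ → (S → A), (∀ x, μ x ∈ Opts x) →
      ∀ s a,
        |R s a - ∑ u ∈ univ.filter (fun u => φ u = φ s), w u * R u (μ (φ s) u)| ≤ εr) :
    -- the value loss L(φ, O_φ) is at most (2/(1-γ))·(ε_r + (γ·RMax/(1-γ))·(ε_p/2)):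
    ∃ μ : Sφ → (S → A), (∀ x, μ x ∈ Opts x) ∧
      ∀ s, Vstar s - Vpol (fun s' => μ (φ s') s') s ≤
        (2 / (1 - γ)) * (εr + (γ * RMax / (1 - γ)) * (εp / 2)) := by
  choose μ hμ using hadm
  refine ⟨μ, hμ, fun s => ?_⟩
  let ρ : Sφ → ℝ := fun x => ∑ u ∈ univ.filter (fun u => φ u = x), w u * R u (μ x u)
  let Q : Sφ → Sφ → ℝ := fun x y => ∑ u ∈ univ.filter (fun u => φ u = x), w u *
    ∑ s' ∈ univ.filter (fun s' => φ s' = y), T u (μ x u) s'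
  have hQ0 : ∀ x y, 0 ≤ Q x y := fun x y =>
    sum_nonneg fun u _ => mul_nonneg (hw u).1 (sum_nonneg fun s' _ => hT0 _ _ _)
  have hQ1 : ∀ x, ∑ y, Q x y = 1 := fun x => by
    simp only [Q]
    rw [sum_comm]
    simp_rw [← mul_sum, sum_fiberwise, hT1, mul_one]
    exact hwsum x
  have hρ0 : ∀ x, 0 ≤ ρ x := fun x =>
    sum_nonneg fun u _ => mul_nonneg (hw u).1 (hR _ _).1
  have hρM : ∀ x, ρ x ≤ RMax := fun x =>
    calc ρ x ≤ ∑ u ∈ univ.filter (fun u => φ u = x), w u * RMax :=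
          sum_le_sum fun u _ => mul_le_mul_of_nonneg_left (hR _ _).2 (hw u).1
      _ = RMax := by rw [← sum_mul, hwsum, one_mul]
  obtain ⟨v, hv⟩ := exists_discounted_value hQ0 hQ1 hγ0 hγ1 ρ
  have hvM : ∀ y, v y ≤ RMax / (1 - γ) :=
    le_div_of_le_add_discounted hQ0 hQ1 hγ0 hγ1 fun x => by linarith [hv x, hρM x]
  have hv0 : ∀ y, 0 ≤ v y := fun y => by
    have := le_div_of_le_add_discounted hQ0 hQ1 hγ0 hγ1 (f := fun x => -v x) (c := 0)
      (fun x => by simp only [mul_neg, sum_neg_distrib]; linarith [hv x, hρ0 x]) y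
    rw [zero_div] at this
    linarith
  have hclose : ∀ (p : S → A) (V : S → ℝ),
      (∀ s, V s = R s (p s) + γ * ∑ s', T s (p s) s' * V s') →
      |V s - v (φ s)| ≤ (εr + γ * (εp * (RMax / (1 - γ) / 2))) / (1 - γ) := fun p V hV =>
    abs_value_sub_abstract_value_le (fun s => hT0 s (p s)) (fun s => hT1 s (p s)) hQ1 hγ0 hγ1
      hV hv hv0 hvM (div_nonneg hRMax.le (by linarith)) (fun s => hKr μ hμ s (p s))
      (fun s => hKp μ hμ s (p s)) s
  have hopt := hclose πstar Vstar fun s => by rw [← hQstar, hπstar]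
  have hpol := hclose _ _ (hVpol fun s' => μ (φ s') s')
  have hbound : (2 / (1 - γ)) * (εr + (γ * RMax / (1 - γ)) * (εp / 2)) =
      2 * ((εr + γ * (εp * (RMax / (1 - γ) / 2))) / (1 - γ)) := by ring
  rw [hbound]
  linarith [(abs_le.mp hopt).2, (abs_le.mp hpol).1]
end

section
/- Let M = (S, A, R, T, γ) be a finite MDP, φ : S → S_φ a state abstraction, x ∈ S_φ an abstract state, and o a φ-relative option for x such that for all s ∈ φ⁻¹(x): max_{s'∈S} |T_o(s'|s, o*_x) − T_o(s'|s, o)| ≤ ε_T and |R_o(s, o*_x) − R_o(s, o)| ≤ ε_R. Then for every s ∈ φ⁻¹(x), |Q*_x(s, o*_x) − Q*_x(s, o)| ≤ ε_R + |S|·ε_T·RMax/(1−γ). -/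
open Finset

/-- A subsolution of a discounted stochastic recursion with constant reward `c` is bounded by
`c / (1 - γ)`. -/
lemma le_div_one_sub_of_le_discounted_sum {S : Type*} [Fintype S] [Nonempty S]
    {P : S → S → ℝ} {γ c : ℝ} {f : S → ℝ}
    (hP0 : ∀ s s', 0 ≤ P s s') (hP1 : ∀ s, ∑ s', P s s' = 1) (hγ0 : 0 ≤ γ) (hγ1 : γ < 1)
    (hf : ∀ s, f s ≤ c + γ * ∑ s', P s s' * f s') (s : S) : f s ≤ c / (1 - γ) := by
  obtain ⟨s₀, hs₀⟩ := Finite.exists_max f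
  refine (hs₀ s).trans ?_
  have hsum : ∑ s', P s₀ s' * f s' ≤ f s₀ := by
    calc ∑ s', P s₀ s' * f s' ≤ ∑ s', P s₀ s' * f s₀ :=
          sum_le_sum fun s' _ => mul_le_mul_of_nonneg_left (hs₀ s') (hP0 s₀ s')
      _ = f s₀ := by rw [← sum_mul, hP1, one_mul]
  rw [le_div_iff₀ (by linarith)]
  linarith [hf s₀, mul_le_mul_of_nonneg_left hsum hγ0]

/-- The homogeneous discounted recursion stopped outside a set has only the zero solution. -/
lemma eq_zero_of_eq_discounted_sum_ite {S : Type*} [Fintype S] [Nonempty S]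
    {P : S → S → ℝ} {γ : ℝ} {D : S → ℝ} {p : S → Prop} [DecidablePred p]
    (hP0 : ∀ s s', 0 ≤ P s s') (hP1 : ∀ s, ∑ s', P s s' = 1) (hγ0 : 0 ≤ γ) (hγ1 : γ < 1)
    (hD : ∀ s, D s = γ * ∑ s', P s s' * (if p s' then D s' else 0)) (s : S) : D s = 0 := by
  have hle : |D s| ≤ 0 / (1 - γ) := by
    refine le_div_one_sub_of_le_discounted_sum (f := fun s => |D s|) hP0 hP1 hγ0 hγ1
      (fun s => ?_) s
    rw [hD s, abs_mul, abs_of_nonneg hγ0, zero_add]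
    refine mul_le_mul_of_nonneg_left ((abs_sum_le_sum_abs _ _).trans
      (sum_le_sum fun s' _ => ?_)) hγ0
    rw [abs_mul, abs_of_nonneg (hP0 s s')]
    refine mul_le_mul_of_nonneg_left ?_ (hP0 s s')
    split_ifs <;> simp
  simpa using hle

/-- The value of running an option until it leaves the set `p` and then collecting `V` is given
by its multi-time reward and transition models. -/
lemma option_value_eq_multi_time_model {S : Type*} [Fintype S] [Nonempty S] [DecidableEq S]
    {P : S → S → ℝ} {γ : ℝ} {r V Q ρ : S → ℝ} {τ : S → S → ℝ} {p : S → Prop} [DecidablePred p]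
    (hP0 : ∀ s s', 0 ≤ P s s') (hP1 : ∀ s, ∑ s', P s s' = 1) (hγ0 : 0 ≤ γ) (hγ1 : γ < 1)
    (hQ : ∀ s, Q s = r s + γ * ∑ s', P s s' * (if p s' then Q s' else V s'))
    (hρ : ∀ s, ρ s = r s + γ * ∑ s', P s s' * (if p s' then ρ s' else 0))
    (hτ : ∀ s s', τ s s' = γ * ∑ s'', P s s'' *
      (if p s'' then τ s'' s' else (if s'' = s' then 1 else 0))) (s : S) :
    Q s = ρ s + ∑ s', τ s s' * V s' := by
  have hτV : ∀ s, ∑ s', τ s s' * V s' =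
      γ * ∑ s'', P s s'' * (if p s'' then ∑ s', τ s'' s' * V s' else V s'') := by
    intro s
    simp_rw [hτ s, mul_assoc, ← mul_sum, sum_mul]
    rw [sum_comm]
    congr 1
    refine sum_congr rfl fun s'' _ => ?_
    simp_rw [mul_assoc, ← mul_sum]
    congr 1
    split_ifs <;> simp
  have hzero := eq_zero_of_eq_discounted_sum_ite
    (D := fun s => Q s - ρ s - ∑ s', τ s s' * V s') (p := p) hP0 hP1 hγ0 hγ1 (fun s => by
      rw [hQ s, hρ s, hτV s, add_sub_add_left_eq_sub, ← mul_sub, ← mul_sub,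
        ← sum_sub_distrib, ← sum_sub_distrib]
      congr 1
      refine sum_congr rfl fun s' _ => ?_
      rw [← mul_sub, ← mul_sub]
      congr 1
      split_ifs <;> simp) s
  linarith

/-- A `φ`-relative option whose multi-time model is `(ε_T, ε_R)`-close to
that of the optimal option `o*_x` has a `Q*`-value within `ε_R + |S|·ε_T·RMax/(1-γ)` of the
optimal option's throughout the block of `x`. -/
theorem stmt_15
    {S A Sφ : Type} [Fintype S] [Fintype A] [Fintype Sφ]
    [Nonempty S] [Nonempty A] [Nonempty Sφ] [DecidableEq S] [DecidableEq Sφ]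
    -- the ground MDP
    (R : S → A → ℝ) (T : S → A → S → ℝ) (γ RMax : ℝ)
    (hRMax : 0 < RMax)
    (hR : ∀ s a, 0 ≤ R s a ∧ R s a ≤ RMax)
    (hT0 : ∀ s a s', 0 ≤ T s a s')
    (hT1 : ∀ s a, ∑ s', T s a s' = 1)
    (hγ0 : 0 ≤ γ) (hγ1 : γ < 1)
    -- optimal value functions of the ground MDP (the unique Bellman fixed point)
    (Qstar : S → A → ℝ) (Vstar : S → ℝ)
    (hVstar : ∀ s, Vstar s = univ.sup' univ_nonempty (fun a => Qstar s a))
    (hQstar : ∀ s a, Qstar s a = R s a + γ * ∑ s', T s a s' * Vstar s')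
    -- the state abstraction
    (φ : S → Sφ) (hφ : Function.Surjective φ)
    -- `Qx x o s`: expected return of running option `o` from `s` until it exits the block of
    -- `x`, and acting optimally thereafter (the unique fixed point of the equation below)
    (Qx : Sφ → (S → A) → S → ℝ)
    (hQx : ∀ x (o : S → A) (s : S), Qx x o s = R s (o s) + γ * ∑ s', T s (o s) s' *
        (if φ s' = x then Qx x o s' else Vstar s'))
    -- an optimal policy of the ground MDP; the optimal option `o*_x` follows it in the block
    (πstar : S → A) (hπstar : ∀ s, Qstar s (πstar s) = Vstar s)
    -- the multi-time reward model of a φ-relative option (unique fixed point)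
    (Ro : Sφ → (S → A) → S → ℝ)
    (hRo : ∀ x (o : S → A) (s : S), Ro x o s = R s (o s) + γ * ∑ s', T s (o s) s' *
        (if φ s' = x then Ro x o s' else 0))
    -- the multi-time transition model of a φ-relative option (unique fixed point)
    (To : Sφ → (S → A) → S → S → ℝ)
    (hTo : ∀ x (o : S → A) (s s' : S), To x o s s' = γ * ∑ s'', T s (o s) s'' *
        (if φ s'' = x then To x o s'' s' else (if s'' = s' then 1 else 0)))
    -- a fixed abstract state and a φ-relative option for it whose multi-time model is
    -- (ε_T, ε_R)-close to that of the optimal option o*_x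
    (x : Sφ) (o : S → A) (εT εR : ℝ)
    (hcloseT : ∀ s, φ s = x → ∀ s', |To x πstar s s' - To x o s s'| ≤ εT)
    (hcloseR : ∀ s, φ s = x → |Ro x πstar s - Ro x o s| ≤ εR) :
    -- then o is nearly optimal in Q*-value throughout the block:
    ∀ s, φ s = x →
      |Qx x πstar s - Qx x o s| ≤ εR + (Fintype.card S : ℝ) * εT * (RMax / (1 - γ)) := by
  have hV : ∀ s, Vstar s = R s (πstar s) + γ * ∑ s', T s (πstar s) s' * Vstar s' := fun s => by
    rw [← hQstar, hπstar]
  have hVub : ∀ s, Vstar s ≤ RMax / (1 - γ) :=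
    le_div_one_sub_of_le_discounted_sum (fun s => hT0 s (πstar s)) (fun s => hT1 s (πstar s))
      hγ0 hγ1 fun s => by linarith [hV s, (hR s (πstar s)).2]
  have hVlb : ∀ s, 0 ≤ Vstar s := fun s => by
    have h := le_div_one_sub_of_le_discounted_sum (c := 0) (f := fun s => -Vstar s)
      (fun s => hT0 s (πstar s)) (fun s => hT1 s (πstar s)) hγ0 hγ1
      (fun s => by
        simp only [mul_neg, sum_neg_distrib]
        linarith [hV s, (hR s (πstar s)).1]) s
    simpa using h
  have hmodel : ∀ o s, Qx x o s = Ro x o s + ∑ s', To x o s s' * Vstar s' := fun o =>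
    option_value_eq_multi_time_model (fun s => hT0 s (o s)) (fun s => hT1 s (o s)) hγ0 hγ1
      (hQx x o) (hRo x o) (hTo x o)
  intro s hs
  rw [hmodel, hmodel, add_sub_add_comm, ← sum_sub_distrib]
  refine (abs_add_le _ _).trans (add_le_add (hcloseR s hs) ((abs_sum_le_sum_abs _ _).trans ?_))
  calc ∑ s', |To x πstar s s' * Vstar s' - To x o s s' * Vstar s'|
      ≤ ∑ _s' : S, εT * (RMax / (1 - γ)) := sum_le_sum fun s' _ => by
        rw [← sub_mul, abs_mul, abs_of_nonneg (hVlb s')]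
        have hT := hcloseT s hs s'
        exact mul_le_mul hT (hVub s') (hVlb s') ((abs_nonneg _).trans hT)
    _ = (Fintype.card S : ℝ) * εT * (RMax / (1 - γ)) := by
        rw [sum_const, card_univ, nsmul_eq_mul, mul_assoc]
end

section
/- Let M = (S, A, R, T, γ) be a finite goal-based MDP and φ : S → S_φ a state abstraction in which every goal state forms its own singleton abstract state. Let x ∈ S_φ be an abstract state containing no goal state, and let o be a φ-relative option for x such that |p(s',k|s, o*_x) − p(s',k|s, o)| ≤ τ for all k ≥ 1, all s ∈ φ⁻¹(x), and all s' ∈ S, where p(s',k|s,o) is the probability that o, started at s, terminates in s' after exactly k steps. Then for every s ∈ φ⁻¹(x), Q*_x(s, o*_x) − Q*_x(s, o) ≤ τ·γ·|S|/(1−γ). -/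
open Finset

/-- In a Markov chain run until it leaves the block `b`, the expected discounted exit value `q` is
approximated geometrically by the contributions of the first `n` possible exit times. -/
theorem abs_exitValue_sub_sum_le {S : Type*} [Fintype S] (b : S → Prop) [DecidablePred b]
    (K : S → S → ℝ) (γ : ℝ) (hK0 : ∀ s s', 0 ≤ K s s') (hK1 : ∀ s, ∑ s', K s s' = 1)
    (hγ0 : 0 ≤ γ) (V q : S → ℝ) (P : ℕ → S → S → ℝ)
    (hq : ∀ s, b s → q s = γ * ∑ s', K s s' * (if b s' then q s' else V s'))
    (hP1 : ∀ s s', P 1 s s' = if b s' then 0 else K s s')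
    (hP2 : ∀ k s s', P (k + 2) s s' =
      ∑ s'' ∈ univ.filter (fun s'' => b s''), K s s'' * P (k + 1) s'' s')
    (C : ℝ) (hC0 : 0 ≤ C) (hC : ∀ s, |q s| ≤ C) (n : ℕ) :
    ∀ s, b s → |q s - ∑ k ∈ range n, γ ^ (k + 1) * ∑ s', P (k + 1) s s' * V s'| ≤ γ ^ n * C := by
  induction n with
  | zero => intro s _; simpa using hC s
  | succ n ih =>
    intro s hs
    set F : S → ℝ := fun s => ∑ k ∈ range n, γ ^ (k + 1) * ∑ s', P (k + 1) s s' * V s' with hF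
    have hstep : ∀ k, γ ^ (k + 1 + 1) * ∑ s', P (k + 1 + 1) s s' * V s' =
        γ * ∑ s'' ∈ univ.filter (fun s'' => b s''),
          K s s'' * (γ ^ (k + 1) * ∑ s', P (k + 1) s'' s' * V s') := by
      intro k
      simp only [hP2, sum_mul, mul_sum]
      rw [sum_comm]
      refine sum_congr rfl fun _ _ => sum_congr rfl fun _ _ => ?_
      ring
    have hsum : ∑ k ∈ range (n + 1), γ ^ (k + 1) * ∑ s', P (k + 1) s s' * V s' =
        γ * ∑ s', K s s' * (if b s' then F s' else V s') := by
      rw [sum_range_succ', sum_congr rfl fun k _ => hstep k, ← mul_sum, sum_comm]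
      simp only [← mul_sum, zero_add, pow_one, hP1]
      rw [← mul_add, sum_filter, ← sum_add_distrib]
      congr 1
      refine sum_congr rfl fun s' _ => ?_
      by_cases h : b s' <;> simp [h, hF]
    rw [hsum, hq s hs, ← mul_sub, ← sum_sub_distrib, abs_mul, abs_of_nonneg hγ0, pow_succ',
      mul_assoc]
    refine mul_le_mul_of_nonneg_left ?_ hγ0
    calc |∑ s', (K s s' * (if b s' then q s' else V s') - K s s' * (if b s' then F s' else V s'))|
        ≤ ∑ s', |K s s' * (if b s' then q s' else V s') -
            K s s' * (if b s' then F s' else V s')| := abs_sum_le_sum_abs _ _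
      _ ≤ ∑ s', K s s' * (γ ^ n * C) := by
        refine sum_le_sum fun s' _ => ?_
        rw [← mul_sub, abs_mul, abs_of_nonneg (hK0 _ _)]
        refine mul_le_mul_of_nonneg_left ?_ (hK0 _ _)
        by_cases h : b s'
        · simpa [h] using ih s' h
        · simpa [h] using by positivity
      _ = γ ^ n * C := by rw [← sum_mul, hK1, one_mul]

/-- A function bounded by its discounted one-step expectations, except at points where it is at
most `c ≥ 0`, is at most `c` everywhere. -/
theorem le_of_le_discounted_expectation {S : Type*} [Fintype S] [Nonempty S]
    (K : S → S → ℝ) (γ : ℝ) (hK0 : ∀ s s', 0 ≤ K s s') (hK1 : ∀ s, ∑ s', K s s' = 1)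
    (hγ0 : 0 ≤ γ) (hγ1 : γ < 1) (f : S → ℝ) (c : ℝ) (hc : 0 ≤ c)
    (hf : ∀ s, f s ≤ c ∨ f s ≤ γ * ∑ s', K s s' * f s') (s : S) : f s ≤ c := by
  obtain ⟨m, hm⟩ := Finite.exists_max f
  refine (hm s).trans ?_
  rcases hf m with h | h
  · exact h
  · have h1 : ∑ s', K m s' * f s' ≤ f m := by
      calc ∑ s', K m s' * f s' ≤ ∑ s', K m s' * f m :=
            sum_le_sum fun s' _ => mul_le_mul_of_nonneg_left (hm s') (hK0 _ _)
        _ = f m := by rw [← sum_mul, hK1, one_mul]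
    have h2 : f m ≤ γ * f m := h.trans (mul_le_mul_of_nonneg_left h1 hγ0)
    nlinarith

theorem sum_mul_eq_of_sum_eq_one_of_eq_one {S : Type*} [Fintype S] [DecidableEq S] (p f : S → ℝ)
    (h0 : ∀ s, 0 ≤ p s) (h1 : ∑ s, p s = 1) (t : S) (ht : p t = 1) : ∑ s, p s * f s = f t := by
  have h := add_sum_erase univ p (mem_univ t)
  have hz : ∑ s ∈ univ.erase t, p s = 0 := by linarith
  rw [sum_eq_zero_iff_of_nonneg fun s _ => h0 s] at hz
  rw [sum_eq_single t, ht, one_mul]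
  · intro s _ hs
    rw [hz s (mem_erase.2 ⟨hs, mem_univ s⟩), zero_mul]
  · simp

/-- In a goal-based MDP, a `φ`-relative option for a goal-free abstract
state whose `k`-step termination-state distributions are `τ`-close to those of the optimal
option `o*_x` is `τ·γ·|S|/(1-γ)`-optimal in `Q*`-value throughout the block of `x`. -/
theorem stmt_16
    {S A Sφ : Type} [Fintype S] [Fintype A] [Fintype Sφ]
    [Nonempty S] [Nonempty A] [Nonempty Sφ] [DecidableEq S] [DecidableEq Sφ]
    -- the ground MDP
    (R : S → A → ℝ) (T : S → A → S → ℝ) (γ : ℝ)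
    (hT0 : ∀ s a s', 0 ≤ T s a s')
    (hT1 : ∀ s a, ∑ s', T s a s' = 1)
    (hγ0 : 0 ≤ γ) (hγ1 : γ < 1)
    -- the MDP is goal-based: reward 1 exactly at goal states, and every goal state moves
    -- with probability 1 to a zero-reward absorbing sink
    (SG : Finset S)
    (hRgoal : ∀ s a, R s a = if s ∈ SG then 1 else 0)
    (sink : S) (hsinkNG : sink ∉ SG)
    (hTgoal : ∀ g ∈ SG, ∀ a, T g a sink = 1)
    (hTsink : ∀ a, T sink a sink = 1)
    -- optimal value functions of the ground MDP (the unique Bellman fixed point)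
    (Qstar : S → A → ℝ) (Vstar : S → ℝ)
    (hVstar : ∀ s, Vstar s = univ.sup' univ_nonempty (fun a => Qstar s a))
    (hQstar : ∀ s a, Qstar s a = R s a + γ * ∑ s', T s a s' * Vstar s')
    -- the state abstraction; every goal state forms its own singleton abstract state
    (φ : S → Sφ) (hφ : Function.Surjective φ)
    (hsingleton : ∀ g ∈ SG, ∀ s, φ s = φ g → s = g)
    -- `Qx x o s`: expected return of running option `o` from `s` until it exits the block of
    -- `x`, and acting optimally thereafter (the unique fixed point of the equation below)
    (Qx : Sφ → (S → A) → S → ℝ)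
    (hQx : ∀ x (o : S → A) (s : S), Qx x o s = R s (o s) + γ * ∑ s', T s (o s) s' *
        (if φ s' = x then Qx x o s' else Vstar s'))
    -- an optimal policy of the ground MDP; the optimal option `o*_x` follows it in the block
    (πstar : S → A) (hπstar : ∀ s, Qstar s (πstar s) = Vstar s)
    -- `Pk x o k s s'`: probability that option `o`, started at `s` in the block of `x`,
    -- terminates in `s'` after exactly `k` steps
    (Pk : Sφ → (S → A) → ℕ → S → S → ℝ)
    (hPk1 : ∀ x (o : S → A) (s s' : S),
      Pk x o 1 s s' = if φ s' = x then 0 else T s (o s) s')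
    (hPk2 : ∀ x (o : S → A) (k : ℕ) (s s' : S),
      Pk x o (k + 2) s s' =
        ∑ s'' ∈ univ.filter (fun s'' => φ s'' = x), T s (o s) s'' * Pk x o (k + 1) s'' s')
    -- a fixed abstract state containing no goal state
    (x : Sφ) (hxNG : ∀ s, φ s = x → s ∉ SG)
    -- a φ-relative option for x whose k-step termination-state distributions are τ-close to
    -- those of the optimal option o*_x
    (o : S → A) (τ : ℝ)
    (hclose : ∀ k : ℕ, 1 ≤ k → ∀ s, φ s = x → ∀ s',
      |Pk x πstar k s s' - Pk x o k s s'| ≤ τ) :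
    -- then o is nearly optimal in Q*-value throughout the block:
    ∀ s, φ s = x → Qx x πstar s - Qx x o s ≤ τ * γ * (Fintype.card S : ℝ) / (1 - γ) := by
  intro s hs
  have hV : ∀ s, Vstar s = R s (πstar s) + γ * ∑ s', T s (πstar s) s' * Vstar s' := fun s => by
    rw [← hπstar s, hQstar]
  have hVsink : Vstar sink = 0 := by
    have h := hV sink
    rw [hRgoal, if_neg hsinkNG, sum_mul_eq_of_sum_eq_one_of_eq_one _ _ (hT0 _ _) (hT1 _ _) sink
      (hTsink _)] at h
    nlinarith
  have hV1 : ∀ s, Vstar s ≤ 1 := by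
    refine le_of_le_discounted_expectation (fun s => T s (πstar s)) γ (fun _ _ => hT0 _ _ _)
      (fun _ => hT1 _ _) hγ0 hγ1 Vstar 1 zero_le_one fun s => ?_
    by_cases h : s ∈ SG
    · left
      rw [hV, hRgoal, if_pos h, sum_mul_eq_of_sum_eq_one_of_eq_one _ _ (hT0 _ _) (hT1 _ _) sink
        (hTgoal s h _), hVsink]
      simp
    · right
      refine (hV s).le.trans ?_
      rw [hRgoal, if_neg h, zero_add]
  have hV0 : ∀ s, 0 ≤ Vstar s := by
    intro s
    have := le_of_le_discounted_expectation (fun s => T s (πstar s)) γ (fun _ _ => hT0 _ _ _)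
      (fun _ => hT1 _ _) hγ0 hγ1 (fun s => -Vstar s) 0 le_rfl (fun s => Or.inr ?_) s
    · linarith
    · have hR : 0 ≤ R s (πstar s) := by rw [hRgoal]; split_ifs <;> norm_num
      simp only [mul_neg, sum_neg_distrib]
      linarith [hV s]
  have happrox : ∀ o' : S → A, ∃ C : ℝ, ∀ n, |Qx x o' s -
      ∑ k ∈ range n, γ ^ (k + 1) * ∑ s', Pk x o' (k + 1) s s' * Vstar s'| ≤ γ ^ n * C := by
    intro o'
    obtain ⟨m, hm⟩ := Finite.exists_max fun s => |Qx x o' s|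
    refine ⟨|Qx x o' m|, fun n => ?_⟩
    refine abs_exitValue_sub_sum_le (fun s => φ s = x) (fun s => T s (o' s)) γ
      (fun _ _ => hT0 _ _ _) (fun _ => hT1 _ _) hγ0 Vstar (Qx x o') (Pk x o') (fun s hs => ?_)
      (hPk1 x o') (hPk2 x o') _ (abs_nonneg _) hm n s hs
    rw [hQx, hRgoal, if_neg (hxNG s hs), zero_add]
  obtain ⟨C₁, h₁⟩ := happrox πstar
  obtain ⟨C₂, h₂⟩ := happrox o
  have hτ : 0 ≤ τ := (abs_nonneg _).trans (hclose 1 le_rfl s hs s)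
  have hterm : ∀ k, ∑ s', Pk x πstar (k + 1) s s' * Vstar s' -
      ∑ s', Pk x o (k + 1) s s' * Vstar s' ≤ τ * Fintype.card S := by
    intro k
    rw [← sum_sub_distrib]
    calc _ ≤ ∑ _s' : S, τ := by
          refine sum_le_sum fun s' _ => ?_
          have h := (le_abs_self _).trans (hclose (k + 1) (by omega) s hs s')
          rw [← sub_mul]
          nlinarith [hV0 s', hV1 s']
      _ = τ * Fintype.card S := by simp [mul_comm]
  have hsum : ∀ n, ∑ k ∈ range n, γ ^ (k + 1) * ∑ s', Pk x πstar (k + 1) s s' * Vstar s' -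
      ∑ k ∈ range n, γ ^ (k + 1) * ∑ s', Pk x o (k + 1) s s' * Vstar s' ≤
        τ * γ * (Fintype.card S : ℝ) / (1 - γ) := by
    intro n
    rw [← sum_sub_distrib]
    calc _ ≤ ∑ k ∈ range n, γ ^ k * (γ * (τ * Fintype.card S)) := by
          refine sum_le_sum fun k _ => ?_
          rw [← mul_sub, ← mul_assoc, ← pow_succ]
          exact mul_le_mul_of_nonneg_left (hterm k) (by positivity)
      _ ≤ (1 - γ)⁻¹ * (γ * (τ * Fintype.card S)) := by
          rw [← sum_mul, ← tsum_geometric_of_lt_one hγ0 hγ1]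
          refine mul_le_mul_of_nonneg_right ?_ (by positivity)
          exact (summable_geometric_of_lt_one hγ0 hγ1).sum_le_tsum _ fun k _ => by positivity
      _ = τ * γ * (Fintype.card S : ℝ) / (1 - γ) := by rw [div_eq_mul_inv]; ring
  have hlim : Filter.Tendsto (fun n : ℕ => τ * γ * (Fintype.card S : ℝ) / (1 - γ) +
      γ ^ n * (C₁ + C₂)) Filter.atTop (nhds (τ * γ * (Fintype.card S : ℝ) / (1 - γ))) := by
    simpa using ((tendsto_pow_atTop_nhds_zero_of_lt_one hγ0 hγ1).mul_const (C₁ + C₂)).const_add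
      (τ * γ * (Fintype.card S : ℝ) / (1 - γ))
  refine ge_of_tendsto' hlim fun n => ?_
  have a := (abs_le.1 (h₁ n)).2
  have b := (abs_le.1 (h₂ n)).1
  linarith [hsum n]
end

section
/- Let M = (S, A, R, T, γ) be a finite MDP, φ : S → S_φ a state abstraction, and O_φ an admissible set of φ-relative options. If the value loss satisfies L(φ, O_φ) ≤ η for some η ≥ 0, then for every abstract state x ∈ S_φ and every state s ∈ φ⁻¹(x) there exists an option o ∈ O_φ for x that is η-optimal in Q-value at s: Q*_x(s, o*_x) − Q*_x(s, o) ≤ η. -/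
open Finset

/-- Minimum principle for a discounted stochastic operator: a function which, wherever it is
negative, dominates its discounted average is nonnegative. -/
theorem nonneg_of_discounted_average_le {S : Type*} [Fintype S] [Nonempty S]
    {P : S → S → ℝ} {γ : ℝ} (hP0 : ∀ s s', 0 ≤ P s s') (hP1 : ∀ s, ∑ s', P s s' = 1)
    (hγ0 : 0 ≤ γ) (hγ1 : γ < 1) {d : S → ℝ}
    (hd : ∀ s, 0 ≤ d s ∨ γ * ∑ s', P s s' * d s' ≤ d s) (s : S) : 0 ≤ d s := by
  obtain ⟨m, hm⟩ := Finite.exists_min d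
  refine le_trans ?_ (hm s)
  rcases hd m with h | h
  · exact h
  · have h1 : d m ≤ ∑ s', P m s' * d s' := by
      calc d m = ∑ s', P m s' * d m := by rw [← Finset.sum_mul, hP1, one_mul]
        _ ≤ _ := Finset.sum_le_sum fun s' _ => mul_le_mul_of_nonneg_left (hm s') (hP0 m s')
    have h2 := mul_le_mul_of_nonneg_left h1 hγ0
    by_contra! hneg
    nlinarith

/-- (Necessary condition for value-preserving state-action abstractions.)
If the value loss of `(φ, O_φ)` is at most `η`, then every abstract state has, at each state
of its block, an option that is `η`-optimal in `Q*`-value. -/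
theorem stmt_17
    {S A Sφ : Type} [Fintype S] [Fintype A] [Fintype Sφ]
    [Nonempty S] [Nonempty A] [Nonempty Sφ] [DecidableEq Sφ]
    -- the ground MDP
    (R : S → A → ℝ) (T : S → A → S → ℝ) (γ RMax : ℝ)
    (hRMax : 0 < RMax)
    (hR : ∀ s a, 0 ≤ R s a ∧ R s a ≤ RMax)
    (hT0 : ∀ s a s', 0 ≤ T s a s')
    (hT1 : ∀ s a, ∑ s', T s a s' = 1)
    (hγ0 : 0 ≤ γ) (hγ1 : γ < 1)
    -- optimal value functions of the ground MDP (the unique Bellman fixed point)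
    (Qstar : S → A → ℝ) (Vstar : S → ℝ)
    (hVstar : ∀ s, Vstar s = univ.sup' univ_nonempty (fun a => Qstar s a))
    (hQstar : ∀ s a, Qstar s a = R s a + γ * ∑ s', T s a s' * Vstar s')
    -- the state abstraction
    (φ : S → Sφ) (hφ : Function.Surjective φ)
    -- an admissible set of φ-relative options: for each abstract state `x`, a nonempty set
    -- of ground policies (the policies of the options initiating exactly in the block of `x`)
    (Opts : Sφ → Set (S → A)) (hadm : ∀ x, (Opts x).Nonempty)
    -- `Qx x o s`: expected return of running option `o` from `s` until it exits the block of
    -- `x`, and acting optimally thereafter (the unique fixed point of the equation below)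
    (Qx : Sφ → (S → A) → S → ℝ)
    (hQx : ∀ x (o : S → A) (s : S), Qx x o s = R s (o s) + γ * ∑ s', T s (o s) s' *
        (if φ s' = x then Qx x o s' else Vstar s'))
    -- an optimal policy of the ground MDP; the optimal option `o*_x` follows it in the block
    (πstar : S → A) (hπstar : ∀ s, Qstar s (πstar s) = Vstar s)
    -- the ground value function of any deterministic ground policy
    (Vpol : (S → A) → S → ℝ)
    (hVpol : ∀ (p : S → A) (s : S), Vpol p s = R s (p s) + γ * ∑ s', T s (p s) s' * Vpol p s')
    -- the value loss L(φ, O_φ) is at most η: some assignment achieves worst-case loss ≤ η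
    (η : ℝ) (hη : 0 ≤ η)
    (hloss : ∃ μ : Sφ → (S → A), (∀ x, μ x ∈ Opts x) ∧
      ∀ s, Vstar s - Vpol (fun s' => μ (φ s') s') s ≤ η) :
    -- then in every abstract state, at every state of its block, some option is η-optimal
    -- in Q*-value:
    ∀ x : Sφ, ∀ s, φ s = x → ∃ o ∈ Opts x, Qx x πstar s - Qx x o s ≤ η := by
  obtain ⟨μ, hμ, hμη⟩ := hloss
  intro x s hs
  refine ⟨μ x, hμ x, ?_⟩
  set p : S → A := fun s' => μ (φ s') s' with hp
  have hVge : ∀ s, Vpol p s ≤ Vstar s := by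
    intro s
    refine sub_nonneg.1 (nonneg_of_discounted_average_le (P := fun s s' => T s (p s) s')
      (d := fun s => Vstar s - Vpol p s)
      (fun s => hT0 s _) (fun s => hT1 s _) hγ0 hγ1 (fun s => Or.inr ?_) s)
    have h1 : Qstar s (p s) ≤ Vstar s := by
      rw [hVstar s]
      exact Finset.le_sup' (fun a => Qstar s a) (Finset.mem_univ (p s))
    rw [hQstar] at h1
    have h2 := hVpol p s
    simp only [mul_sub, Finset.sum_sub_distrib]
    linarith
  have hopt : Qx x πstar s ≤ Vstar s := by
    have h := nonneg_of_discounted_average_le (P := fun s s' => T s (πstar s) s')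
      (d := fun s => Vstar s - if φ s = x then Qx x πstar s else Vstar s)
      (fun s => hT0 s _) (fun s => hT1 s _) hγ0 hγ1 (fun s => ?_) s
    · simpa [hs] using h
    · by_cases hx : φ s = x
      · right
        have h1 := hQx x πstar s
        have h2 := hQstar s (πstar s)
        rw [hπstar] at h2
        simp only [mul_sub, Finset.sum_sub_distrib]
        rw [if_pos hx]
        linarith
      · left
        simp [hx]
  have hpol : Vpol p s ≤ Qx x (μ x) s := by
    have h := nonneg_of_discounted_average_le (P := fun s s' => T s (p s) s')
      (d := fun s => (if φ s = x then Qx x (μ x) s else Vstar s) - Vpol p s)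
      (fun s => hT0 s _) (fun s => hT1 s _) hγ0 hγ1 (fun s => ?_) s
    · simpa [hs] using h
    · by_cases hx : φ s = x
      · right
        have h1 := hQx x (μ x) s
        have h2 := hVpol p s
        have h3 : p s = μ x s := by rw [hp, ← hx]
        simp only [mul_sub, Finset.sum_sub_distrib]
        rw [if_pos hx]
        rw [h3] at h2 ⊢
        linarith
      · left
        simpa [hx] using hVge s
  linarith [hμη s]
end

section
/- Let M = (S, A, R, T, γ) be a finite MDP, φ : S → S_φ a state abstraction, and O_φ an admissible set of φ-relative options. Let μ be a deterministic assignment of one option of O_φ to each abstract state such that for every abstract state x, max_{s : φ(s)=x} (Q*_x(s, o*_x) − Q*_x(s, μ(x))) ≤ ε_Q. For t ≥ 0 and s ∈ S, let Q_t(s) denote the expected discounted return of, starting from s, carrying out t+1 consecutive option executions prescribed by μ (at each option termination, executing the option μ assigns to the current abstract state) and thereafter following an optimal policy π* of M. Then for every t ≥ 0 and every s ∈ S, V*(s) − Q_t(s) ≤ Σ_{i=0}^{t} ε_Q·γ^i. -/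
open Finset

/-- A maximum principle for discounted stochastic kernels: a function dominated by the discounted
expectation of its maximum with a constant `c ≥ 0` is at most `γ * c`. -/
theorem le_mul_of_le_discounted_max {S : Type*} [Fintype S] {P : S → S → ℝ} {γ c : ℝ}
    (hP0 : ∀ s s', 0 ≤ P s s') (hP1 : ∀ s, ∑ s', P s s' = 1) (hγ0 : 0 ≤ γ) (hγ1 : γ < 1)
    (hc : 0 ≤ c) {f : S → ℝ} (hf : ∀ s, f s ≤ γ * ∑ s', P s s' * max (f s') c) (s : S) :
    f s ≤ γ * c := by
  have : Nonempty S := ⟨s⟩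
  obtain ⟨m, hm⟩ := Finite.exists_max f
  have hbound : ∀ s, f s ≤ γ * max (f m) c := fun s => by
    refine (hf s).trans (mul_le_mul_of_nonneg_left ?_ hγ0)
    calc ∑ s', P s s' * max (f s') c
        ≤ ∑ s', P s s' * max (f m) c := Finset.sum_le_sum fun s' _ =>
          mul_le_mul_of_nonneg_left (max_le_max_right c (hm s')) (hP0 s s')
      _ = max (f m) c := by rw [← Finset.sum_mul, hP1, one_mul]
  rcases le_total (f m) c with h | h
  · simpa [max_eq_right h] using hbound s
  · have hfm := hbound m
    rw [max_eq_left h] at hfm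
    have : f m ≤ 0 := by nlinarith
    exact (hm s).trans (this.trans (mul_nonneg hγ0 hc))

/-- Comparison of two one-step backups: if `f` and `g` are a sub- and a super-solution with the
same reward and kernel, and their continuations differ by at most `max (f - g) c`, then they
differ by at most `γ * c`. -/
theorem sub_le_mul_of_backup {S : Type*} [Fintype S] {P : S → S → ℝ} {γ c : ℝ}
    (hP0 : ∀ s s', 0 ≤ P s s') (hP1 : ∀ s, ∑ s', P s s' = 1) (hγ0 : 0 ≤ γ) (hγ1 : γ < 1)
    (hc : 0 ≤ c) {f g r : S → ℝ} {F G : S → S → ℝ}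
    (hf : ∀ s, f s ≤ r s + γ * ∑ s', P s s' * F s s')
    (hg : ∀ s, r s + γ * ∑ s', P s s' * G s s' ≤ g s)
    (hFG : ∀ s s', F s s' - G s s' ≤ max (f s' - g s') c) (s : S) :
    f s - g s ≤ γ * c := by
  refine le_mul_of_le_discounted_max (f := fun s => f s - g s) hP0 hP1 hγ0 hγ1 hc (fun s => ?_) s
  calc f s - g s ≤ γ * ∑ s', P s s' * (F s s' - G s s') := by
        simp only [mul_sub, Finset.sum_sub_distrib]
        linarith [hf s, hg s]
    _ ≤ γ * ∑ s', P s s' * max (f s' - g s') c :=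
        mul_le_mul_of_nonneg_left (Finset.sum_le_sum fun s' _ =>
          mul_le_mul_of_nonneg_left (hFG s s') (hP0 s s')) hγ0

/-- (Inductive step in the proof of the `O_{φ,Q*_ε}` value-loss bound.)
If the assignment `μ` picks an `ε_Q`-optimal option in every abstract state, then executing
`t+1` options under `μ` and acting optimally thereafter loses at most `Σ_{i≤t} ε_Q γ^i`. -/
theorem stmt_18
    {S A Sφ : Type} [Fintype S] [Fintype A] [Fintype Sφ]
    [Nonempty S] [Nonempty A] [Nonempty Sφ] [DecidableEq Sφ]
    -- the ground MDP
    (R : S → A → ℝ) (T : S → A → S → ℝ) (γ RMax : ℝ)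
    (hRMax : 0 < RMax)
    (hR : ∀ s a, 0 ≤ R s a ∧ R s a ≤ RMax)
    (hT0 : ∀ s a s', 0 ≤ T s a s')
    (hT1 : ∀ s a, ∑ s', T s a s' = 1)
    (hγ0 : 0 ≤ γ) (hγ1 : γ < 1)
    -- optimal value functions of the ground MDP (the unique Bellman fixed point)
    (Qstar : S → A → ℝ) (Vstar : S → ℝ)
    (hVstar : ∀ s, Vstar s = univ.sup' univ_nonempty (fun a => Qstar s a))
    (hQstar : ∀ s a, Qstar s a = R s a + γ * ∑ s', T s a s' * Vstar s')
    -- the state abstraction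
    (φ : S → Sφ) (hφ : Function.Surjective φ)
    -- an admissible set of φ-relative options: for each abstract state `x`, a nonempty set
    -- of ground policies (the policies of the options initiating exactly in the block of `x`)
    (Opts : Sφ → Set (S → A)) (hadm : ∀ x, (Opts x).Nonempty)
    -- `Qx x o s`: expected return of running option `o` from `s` until it exits the block of
    -- `x`, and acting optimally thereafter (the unique fixed point of the equation below)
    (Qx : Sφ → (S → A) → S → ℝ)
    (hQx : ∀ x (o : S → A) (s : S), Qx x o s = R s (o s) + γ * ∑ s', T s (o s) s' *
        (if φ s' = x then Qx x o s' else Vstar s'))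
    -- an optimal policy of the ground MDP; the optimal option `o*_x` follows it in the block
    (πstar : S → A) (hπstar : ∀ s, Qstar s (πstar s) = Vstar s)
    -- a deterministic assignment of options whose Q*-values are ε_Q-close to optimal
    (μ : Sφ → S → A) (hμ : ∀ x, μ x ∈ Opts x)
    (εQ : ℝ)
    (hμopt : ∀ x, ∀ s, φ s = x → Qx x πstar s - Qx x (μ x) s ≤ εQ)
    -- `Qt t s`: expected discounted return of, from `s`, carrying out `t+1` consecutive
    -- option executions prescribed by `μ` and following the optimal policy thereafter;
    -- `Qt (t+1)` is the unique fixed point of its within-block equation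
    (Qt : ℕ → S → ℝ)
    (hQt0 : ∀ s, Qt 0 s = Qx (φ s) (μ (φ s)) s)
    (hQtsucc : ∀ (t : ℕ) (s : S), Qt (t + 1) s =
      R s (μ (φ s) s) + γ * ∑ s', T s (μ (φ s) s) s' *
        (if φ s' = φ s then Qt (t + 1) s' else Qt t s')) :
    -- then every t-fold option execution is nearly optimal:
    ∀ (t : ℕ) (s : S), Vstar s - Qt t s ≤ ∑ i ∈ Finset.range (t + 1), εQ * γ ^ i := by
  have hVle : ∀ x s, Vstar s ≤ Qx x πstar s := fun x s => by
    have h := sub_le_mul_of_backup (P := fun s => T s (πstar s)) (c := 0)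
      (f := Vstar) (g := Qx x πstar) (r := fun s => R s (πstar s)) (F := fun _ => Vstar)
      (fun s => hT0 s _) (fun s => hT1 s _) hγ0 hγ1 le_rfl
      (fun s => by rw [← hQstar, hπstar]) (fun s => (hQx x πstar s).ge)
      (fun _ s' => by split_ifs <;> simp) s
    linarith
  have hleV : ∀ x o s, Qx x o s ≤ Vstar s := fun x o s => by
    have h := sub_le_mul_of_backup (P := fun s => T s (o s)) (c := 0)
      (f := Qx x o) (g := Vstar) (r := fun s => R s (o s)) (G := fun _ => Vstar)
      (fun s => hT0 s _) (fun s => hT1 s _) hγ0 hγ1 le_rfl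
      (fun s => (hQx x o s).le)
      (fun s => by
        rw [← hQstar, hVstar]
        exact le_sup' (fun a => Qstar s a) (mem_univ _))
      (fun _ s' => by split_ifs <;> simp) s
    linarith
  have hloss : ∀ s, Vstar s - Qx (φ s) (μ (φ s)) s ≤ εQ := fun s => by
    linarith [hμopt (φ s) s rfl, hVle (φ s) s]
  have hε : 0 ≤ εQ := by
    obtain ⟨s⟩ := ‹Nonempty S›
    linarith [hloss s, hleV (φ s) (μ (φ s)) s]
  intro t
  induction t with
  | zero => intro s; simpa [hQt0] using hloss s
  | succ t ih =>
    intro s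
    have hc : 0 ≤ ∑ i ∈ range (t + 1), εQ * γ ^ i :=
      sum_nonneg fun i _ => mul_nonneg hε (pow_nonneg hγ0 i)
    have h := sub_le_mul_of_backup (P := fun s => T s (μ (φ s) s))
      (f := fun s => Qx (φ s) (μ (φ s)) s) (g := Qt (t + 1)) (r := fun s => R s (μ (φ s) s))
      (fun s => hT0 s _) (fun s => hT1 s _) hγ0 hγ1 hc
      (fun s => (hQx (φ s) (μ (φ s)) s).le) (fun s => (hQtsucc t s).ge)
      (fun s s' => by
        split_ifs with hs
        · rw [hs]; exact le_max_left _ _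
        · exact (ih s').trans (le_max_right _ _)) s
    have hsum : ∑ i ∈ range (t + 1 + 1), εQ * γ ^ i
        = γ * (∑ i ∈ range (t + 1), εQ * γ ^ i) + εQ := by
      rw [sum_range_succ', mul_sum]
      simp [pow_succ, mul_comm, mul_left_comm]
    linarith [hloss s]
end
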